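/- arXiv:2601.23120 — 3 statements merged into one kernel-verified Lean document; each statement's English description precedes it below -/
import Mathlib

section
/- Assume f : ℝⁿ → ℝ and g : ℝᵐ → ℝ are differentiable convex functions with ∇f L₁-Lipschitz and ∇g L₂-Lipschitz, α, β, ε : [t₀, ∞) → (0, ∞) are C¹, θ > 0 and t₀ > 0 are constants, K : ℝⁿ → ℝᵐ is linear with adjoint K*, α(t) ≥ (1 + θ)/(θ t), β′(t)/β(t) ≤ (1 − 2θ)/(θ t), and α(t) + tα′(t) ≤ tβ(t)ε(t) for all t ≥ t₀, ε is nonincreasing with ∫_{t₀}^∞ tβ(t)ε(t) dt < ∞, and lim_{t→∞} t²β(t) = +∞. Then for every twice continuously differentiable global solution (x(t), y(t)) of the dynamical system (15) and every saddle point (x*, y*) of L there exists a constant C > 0 such that ‖∇f(x(t)) − ∇f(x*)‖ ≤ C/(t√β(t)) and ‖∇g(y(t)) − ∇g(y*)‖ ≤ C/(t√β(t)) for all t ≥ t₀. -/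
open scoped RealInnerProductSpace
open MeasureTheory Filter Asymptotics

noncomputable section

/-- The bilinear Lagrangian `L(x, y) = f(x) + ⟨Kx, y⟩ - g(y)`. -/
def Lag {n m : ℕ} (f : EuclideanSpace ℝ (Fin n) → ℝ) (g : EuclideanSpace ℝ (Fin m) → ℝ)
    (K : EuclideanSpace ℝ (Fin n) →L[ℝ] EuclideanSpace ℝ (Fin m))
    (x : EuclideanSpace ℝ (Fin n)) (y : EuclideanSpace ℝ (Fin m)) : ℝ :=
  f x + ⟪K x, y⟫ - g y

/-- `(x*, y*)` is a saddle point of the Lagrangian `L`: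
`L(x*, y) ≤ L(x*, y*) ≤ L(x, y*)` for all `(x, y)`. -/
def IsSaddle {n m : ℕ} (f : EuclideanSpace ℝ (Fin n) → ℝ) (g : EuclideanSpace ℝ (Fin m) → ℝ)
    (K : EuclideanSpace ℝ (Fin n) →L[ℝ] EuclideanSpace ℝ (Fin m))
    (xs : EuclideanSpace ℝ (Fin n)) (ys : EuclideanSpace ℝ (Fin m)) : Prop :=
  ∀ x y, Lag f g K xs y ≤ Lag f g K xs ys ∧ Lag f g K xs ys ≤ Lag f g K x ys

/-- `(x, y)` is a twice continuously differentiable global solution on `[t₀, ∞)` of the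
Tikhonov regularized second-order primal-dual dynamical system (15):
`ẍ + α(t)ẋ + β(t)[∇f(x) + ε(t)x + K*(y + θtẏ)] = 0`,
`ÿ + α(t)ẏ − β(t)[K(x + θtẋ) − ∇g(y) − ε(t)y] = 0`. -/
def IsSol {n m : ℕ} (t₀ θ : ℝ)
    (f : EuclideanSpace ℝ (Fin n) → ℝ) (g : EuclideanSpace ℝ (Fin m) → ℝ)
    (K : EuclideanSpace ℝ (Fin n) →L[ℝ] EuclideanSpace ℝ (Fin m))
    (α β ε : ℝ → ℝ)
    (x : ℝ → EuclideanSpace ℝ (Fin n)) (y : ℝ → EuclideanSpace ℝ (Fin m)) : Prop :=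
  ContDiffOn ℝ 2 x (Set.Ici t₀) ∧ ContDiffOn ℝ 2 y (Set.Ici t₀) ∧
  ∀ t ≥ t₀,
    deriv (deriv x) t + α t • deriv x t
      + β t • (gradient f (x t) + ε t • x t
        + (ContinuousLinearMap.adjoint K) (y t + (θ * t) • deriv y t)) = 0 ∧
    deriv (deriv y) t + α t • deriv y t
      - β t • (K (x t + (θ * t) • deriv x t) - gradient g (y t) - ε t • y t) = 0


section helpers
variable {E : Type*} [NormedAddCommGroup E] [InnerProductSpace ℝ E] [CompleteSpace E]

lemma aux_comp (f : E → ℝ) (hf : Differentiable ℝ f) (x : ℝ → E) (x' : E) (t : ℝ)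
    (hx : HasDerivAt x x' t) : HasDerivAt (fun s => f (x s)) ⟪gradient f (x t), x'⟫ t := by
  have h := (hf (x t)).hasGradientAt.hasFDerivAt.comp_hasDerivAt t hx
  exact h.congr_deriv (by simp)

lemma aux_grad_ineq (f : E → ℝ) (hf : Differentiable ℝ f) (hc : ConvexOn ℝ Set.univ f) (u v : E) :
    f u + ⟪gradient f u, v - u⟫ ≤ f v := by
  have hl : HasDerivAt (fun s : ℝ => u + s • (v - u)) (v - u) 0 := by
    simpa using ((hasDerivAt_id (0:ℝ)).smul_const (v - u)).const_add u
  have hd := aux_comp f hf _ _ 0 hl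
  have hcc : ConvexOn ℝ Set.univ (fun s : ℝ => f (u + s • (v - u))) := by
    refine ⟨convex_univ, fun a _ b _ p q hp hq hpq => ?_⟩
    have := hc.2 (Set.mem_univ (u + a • (v - u))) (Set.mem_univ (u + b • (v - u))) hp hq hpq
    refine le_trans (le_of_eq ?_) this
    change f _ = f _
    congr 1
    obtain rfl : q = 1 - p := by linarith
    simp only [smul_eq_mul]
    module
  have := hcc.le_slope_of_hasDerivAt (Set.mem_univ 0) (Set.mem_univ 1) one_pos hd
  rw [slope_def_field] at this
  simp only [zero_smul, add_zero, one_smul, sub_zero, div_one, add_sub_cancel] at this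
  linarith

lemma aux_coco (f : E → ℝ) (hf : Differentiable ℝ f) (hc : ConvexOn ℝ Set.univ f) (L : ℝ)
    (hL : 0 < L) (hLip : ∀ u v, ‖gradient f u - gradient f v‖ ≤ L * ‖u - v‖) (u v : E) :
    f v + ⟪gradient f v, u - v⟫ + 1 / (4 * L) * ‖gradient f u - gradient f v‖ ^ 2 ≤ f u := by
  set D := gradient f u - gradient f v with hD
  set c := 1 / (2 * L) with hcdef
  have hcpos : 0 < c := by positivity
  have h1 := aux_grad_ineq f hf hc v (u - c • D)
  have h2 := aux_grad_ineq f hf hc (u - c • D) u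
  have h3 := hLip u (u - c • D)
  have e1 : u - (u - c • D) = c • D := by abel
  rw [e1] at h2 h3
  rw [norm_smul, Real.norm_of_nonneg hcpos.le] at h3
  have h4 : ⟪gradient f u - gradient f (u - c • D), D⟫ ≤ 1 / 2 * ‖D‖ ^ 2 := by
    calc _ ≤ ‖gradient f u - gradient f (u - c • D)‖ * ‖D‖ := real_inner_le_norm _ _
      _ ≤ (L * (c * ‖D‖)) * ‖D‖ := by gcongr
      _ = _ := by rw [hcdef]; field_simp
  have h5 : ⟪gradient f u, D⟫ - ⟪gradient f v, D⟫ = ‖D‖ ^ 2 := by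
    rw [← inner_sub_left, ← hD, real_inner_self_eq_norm_sq]
  have e2 : u - c • D - v = (u - v) - c • D := by abel
  rw [e2, inner_sub_right, inner_smul_right] at h1
  rw [inner_smul_right] at h2
  rw [inner_sub_left] at h4
  have h6 : 1 / (4 * L) = c / 2 := by rw [hcdef]; field_simp; norm_num
  rw [h6]
  have h7 := mul_le_mul_of_nonneg_left h4 hcpos.le
  have h8 := congrArg (fun z => c * z) h5
  nlinarith

end helpers

lemma aux_half {E : Type*} [NormedAddCommGroup E] [InnerProductSpace ℝ E] (x x' : ℝ → E) (α : ℝ → ℝ) (t θ α' b : ℝ) (x'' w xs : E)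
    (hx : HasDerivAt x (x' t) t) (hx' : HasDerivAt x' x'' t) (hα : HasDerivAt α α' t)
    (heq : x'' + α t • x' t + b • w = 0) :
    HasDerivAt (fun s => 1 / 2 * ‖x s - xs + (θ * s) • x' s‖ ^ 2
        + (θ * s * α s - 1 - θ) / 2 * ‖x s - xs‖ ^ 2)
      (-θ * t * (θ * t * α t - 1 - θ) * ‖x' t‖ ^ 2
        + θ * (α t + t * α') / 2 * ‖x t - xs‖ ^ 2
        - θ * t * b * ⟪x t - xs, w⟫ - θ ^ 2 * t ^ 2 * b * ⟪x' t, w⟫) t := by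
  have hθ : HasDerivAt (fun s : ℝ => θ * s) θ t := by
    simpa using (hasDerivAt_id t).const_mul θ
  have hxs := hx.sub_const xs
  have h1 := (hxs.add (hθ.smul hx')).norm_sq.const_mul (1 / 2 : ℝ)
  have h2 := ((((hθ.mul hα).sub_const 1).sub_const θ).div_const 2).mul hxs.norm_sq
  have hx2 : x'' = -(α t • x' t) - b • w := by
    rw [← sub_eq_zero, ← heq]; abel
  refine (h1.add h2).congr_deriv ?_
  subst hx2
  simp only [Pi.add_apply, Pi.mul_apply, Pi.smul_apply', ← real_inner_self_eq_norm_sq,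
    inner_add_left, inner_add_right, inner_sub_right, inner_smul_left, inner_smul_right,
    inner_neg_right]
  simp only [inner_sub_left, real_inner_comm, RCLike.conj_to_real]
  ring


lemma aux_C1 (a : ℝ → ℝ) (t₀ : ℝ) (h : ContDiffOn ℝ 1 a (Set.Ici t₀)) :
    ∀ t > t₀, HasDerivAt a (deriv a t) t := fun t ht =>
  ((h.contDiffAt (Ici_mem_nhds ht)).differentiableAt (by norm_num)).hasDerivAt

lemma aux_C2 {E : Type*} [NormedAddCommGroup E] [NormedSpace ℝ E] (x : ℝ → E) (t₀ : ℝ)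
    (h : ContDiffOn ℝ 2 x (Set.Ici t₀)) :
    ∀ t > t₀, HasDerivAt x (deriv x t) t ∧ HasDerivAt (deriv x) (deriv (deriv x) t) t := by
  intro t ht
  have h' : ContDiffOn ℝ (1 + 1) x (Set.Ioi t₀) := by
    have := h.mono Set.Ioi_subset_Ici_self
    rwa [one_add_one_eq_two]
  rw [contDiffOn_succ_iff_deriv_of_isOpen isOpen_Ioi] at h'
  refine ⟨(h'.1.differentiableAt (Ioi_mem_nhds ht)).hasDerivAt, ?_⟩
  exact ((h'.2.2.contDiffAt (Ioi_mem_nhds ht)).differentiableAt (by norm_num)).hasDerivAt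

lemma aux_bound {E : Type*} [NormedAddCommGroup E] (t₀ t₁ L B : ℝ) (β : ℝ → ℝ)
    (hβc : ContinuousOn β (Set.Ici t₀)) (hβ : ∀ t ≥ t₀, 0 < β t) (x : ℝ → E)
    (hx : ContinuousOn x (Set.Ici t₀)) (xs : E) (G : ℝ → E) (ht₀ : 0 < t₀)
    (hG : ∀ t ≥ t₀, ‖G t‖ ≤ L * ‖x t - xs‖)
    (hB : ∀ t ≥ t₁, ‖G t‖ ^ 2 * (t ^ 2 * β t) ≤ B) :
    ∃ C, ∀ t ≥ t₀, ‖G t‖ * (t * Real.sqrt (β t)) ≤ C := by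
  have hcont : ContinuousOn (fun t => L * ‖x t - xs‖ * (t * Real.sqrt (β t))) (Set.Icc t₀ t₁) := by
    have h1 := hx.mono (t := Set.Icc t₀ t₁) (fun s (hs : s ∈ Set.Icc t₀ t₁) => hs.1)
    have h2 := hβc.mono (t := Set.Icc t₀ t₁) (fun s (hs : s ∈ Set.Icc t₀ t₁) => hs.1)
    fun_prop
  obtain ⟨C, hC⟩ := isCompact_Icc.bddAbove_image hcont
  refine ⟨max C (B + 1), fun t ht => ?_⟩
  have htp : 0 < t := lt_of_lt_of_le ht₀ ht
  rcases le_total t t₁ with h | h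
  · refine le_trans ?_ (le_max_left _ _)
    refine le_trans ?_ (hC (Set.mem_image_of_mem _ ⟨ht, h⟩))
    exact mul_le_mul_of_nonneg_right (hG t ht) (by positivity)
  · refine le_trans ?_ (le_max_right _ _)
    have h1 := hB t h
    have h2 : (‖G t‖ * (t * Real.sqrt (β t))) ^ 2 ≤ B := by
      rw [mul_pow, mul_pow, Real.sq_sqrt (hβ t ht).le]
      exact h1
    nlinarith [sq_nonneg (‖G t‖ * (t * Real.sqrt (β t)) - 1),
      sq_nonneg (‖G t‖ * (t * Real.sqrt (β t)))]

/-- Theorem 3.1, gradient decay: with `L₁`-, `L₂`-Lipschitz gradients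
and the fast-decay condition `∫ tβ(t)ε(t) dt < ∞`, the gradient residuals along any
solution of (15) are `O(1/(t√β(t)))`. -/
theorem stmt_11 {n m : ℕ} (t₀ θ L₁ L₂ : ℝ) (ht₀ : 0 < t₀) (hθ : 0 < θ)
    (hL₁ : 0 < L₁) (hL₂ : 0 < L₂)
    (f : EuclideanSpace ℝ (Fin n) → ℝ) (g : EuclideanSpace ℝ (Fin m) → ℝ)
    (hf : Differentiable ℝ f) (hg : Differentiable ℝ g)
    (hfconv : ConvexOn ℝ Set.univ f) (hgconv : ConvexOn ℝ Set.univ g)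
    (K : EuclideanSpace ℝ (Fin n) →L[ℝ] EuclideanSpace ℝ (Fin m))
    (α β ε : ℝ → ℝ)
    (hαC1 : ContDiffOn ℝ 1 α (Set.Ici t₀)) (hβC1 : ContDiffOn ℝ 1 β (Set.Ici t₀))
    (hεC1 : ContDiffOn ℝ 1 ε (Set.Ici t₀))
    (hαpos : ∀ t ≥ t₀, 0 < α t) (hβpos : ∀ t ≥ t₀, 0 < β t) (hεpos : ∀ t ≥ t₀, 0 < ε t)
    (hα : ∀ t ≥ t₀, (1 + θ) / (θ * t) ≤ α t)
    (hfLip : ∀ u v, ‖gradient f u - gradient f v‖ ≤ L₁ * ‖u - v‖)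
    (hgLip : ∀ u v, ‖gradient g u - gradient g v‖ ≤ L₂ * ‖u - v‖)
    (hβ' : ∀ t ≥ t₀, deriv β t / β t ≤ (1 - 2 * θ) / (θ * t))
    (hαε : ∀ t ≥ t₀, α t + t * deriv α t ≤ t * β t * ε t)
    (hεanti : AntitoneOn ε (Set.Ici t₀))
    (hεint : IntegrableOn (fun t => t * β t * ε t) (Set.Ioi t₀))
    (hβtop : Tendsto (fun t => t ^ 2 * β t) atTop atTop)
    (hΩ : ∃ p : EuclideanSpace ℝ (Fin n) × EuclideanSpace ℝ (Fin m),
      IsSaddle f g K p.1 p.2)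
    (x : ℝ → EuclideanSpace ℝ (Fin n)) (y : ℝ → EuclideanSpace ℝ (Fin m))
    (hsol : IsSol t₀ θ f g K α β ε x y)
    (xs : EuclideanSpace ℝ (Fin n)) (ys : EuclideanSpace ℝ (Fin m))
    (hsaddle : IsSaddle f g K xs ys) :
    ∃ C > 0, ∀ t ≥ t₀,
      ‖gradient f (x t) - gradient f xs‖ ≤ C / (t * Real.sqrt (β t)) ∧
      ‖gradient g (y t) - gradient g ys‖ ≤ C / (t * Real.sqrt (β t)) := by
  obtain ⟨hxC, hyC, hode⟩ := hsol
  have hxd : ∀ t > t₀, HasDerivAt x (deriv x t) t ∧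
      HasDerivAt (deriv x) (deriv (deriv x) t) t := aux_C2 x t₀ hxC
  have hyd : ∀ t > t₀, HasDerivAt y (deriv y t) t ∧
      HasDerivAt (deriv y) (deriv (deriv y) t) t := aux_C2 y t₀ hyC
  have hαd := aux_C1 α t₀ hαC1
  have hβd := aux_C1 β t₀ hβC1
  have hεd := aux_C1 ε t₀ hεC1
  -- optimality conditions
  have hGx : gradient f xs = -(ContinuousLinearMap.adjoint K) ys := by
    have hgr : HasFDerivAt (fun u => f u + ⟪(ContinuousLinearMap.adjoint K) ys, u⟫)
        (InnerProductSpace.toDual ℝ _ (gradient f xs)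
          + InnerProductSpace.toDual ℝ _ ((ContinuousLinearMap.adjoint K) ys)) xs :=
      (hf xs).hasGradientAt.hasFDerivAt.add
        (InnerProductSpace.toDual ℝ _ ((ContinuousLinearMap.adjoint K) ys)).hasFDerivAt
    have hmin : IsLocalMin (fun u => f u + ⟪(ContinuousLinearMap.adjoint K) ys, u⟫) xs := by
      refine Eventually.of_forall fun u => ?_
      have := (hsaddle u ys).2
      simp only [Lag] at this
      simp only [ContinuousLinearMap.adjoint_inner_left, real_inner_comm (K _) ys] at this ⊢
      linarith
    have h0 := hmin.hasFDerivAt_eq_zero hgr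
    rw [← map_add, LinearIsometryEquiv.map_eq_zero_iff] at h0
    exact eq_neg_of_add_eq_zero_left h0
  have hGy : gradient g ys = K xs := by
    have hgr : HasFDerivAt (fun u => g u - ⟪K xs, u⟫)
        (InnerProductSpace.toDual ℝ _ (gradient g ys)
          - InnerProductSpace.toDual ℝ _ (K xs)) ys :=
      (hg ys).hasGradientAt.hasFDerivAt.sub
        (InnerProductSpace.toDual ℝ _ (K xs)).hasFDerivAt
    have hmin : IsLocalMin (fun u => g u - ⟪K xs, u⟫) ys := by
      refine Eventually.of_forall fun u => ?_
      have := (hsaddle xs u).1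
      simp only [Lag] at this
      simp only
      linarith
    have h0 := hmin.hasFDerivAt_eq_zero hgr
    rw [← map_sub, LinearIsometryEquiv.map_eq_zero_iff] at h0
    exact sub_eq_zero.1 h0
  -- the energy
  set F : ℝ → ℝ := fun s => f (x s) - f xs + ⟪K (x s), ys⟫ - ⟪K xs, y s⟫ + g (y s) - g ys
    + ε s / 2 * (‖x s‖ ^ 2 + ‖y s‖ ^ 2) with hF
  have hFlow : ∀ t ≥ t₀, 1 / (4 * L₁) * ‖gradient f (x t) - gradient f xs‖ ^ 2
      + 1 / (4 * L₂) * ‖gradient g (y t) - gradient g ys‖ ^ 2 ≤ F t := by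
    intro t ht
    have h1 := aux_coco f hf hfconv L₁ hL₁ hfLip (x t) xs
    have h2 := aux_coco g hg hgconv L₂ hL₂ hgLip (y t) ys
    have h3 : 0 ≤ ε t / 2 * (‖x t‖ ^ 2 + ‖y t‖ ^ 2) := by
      have := hεpos t ht
      positivity
    have h4 : ⟪gradient f xs, x t - xs⟫ = -⟪K (x t), ys⟫ + ⟪K xs, ys⟫ := by
      rw [hGx, inner_neg_left, ContinuousLinearMap.adjoint_inner_left, map_sub, inner_sub_right,
        real_inner_comm, real_inner_comm (K xs) ys]
      ring
    have h5 : ⟪gradient g ys, y t - ys⟫ = ⟪K xs, y t⟫ - ⟪K xs, ys⟫ := by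
      rw [hGy, inner_sub_right]
    simp only [hF]
    linarith
  have hF0 : ∀ t ≥ t₀, 0 ≤ F t := fun t ht => le_trans (by positivity) (hFlow t ht)
  set En : ℝ → ℝ := fun s => θ ^ 2 * s ^ 2 * β s * F s
    + ((1 / 2 * ‖x s - xs + (θ * s) • deriv x s‖ ^ 2
        + (θ * s * α s - 1 - θ) / 2 * ‖x s - xs‖ ^ 2)
    + (1 / 2 * ‖y s - ys + (θ * s) • deriv y s‖ ^ 2
        + (θ * s * α s - 1 - θ) / 2 * ‖y s - ys‖ ^ 2)) with hEn
  have hξ : ∀ t ≥ t₀, 0 ≤ θ * t * α t - 1 - θ := by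
    intro t ht
    have htp : 0 < t := lt_of_lt_of_le ht₀ ht
    have := hα t ht
    rw [div_le_iff₀ (by positivity)] at this
    linarith
  have hEnlow : ∀ t ≥ t₀, θ ^ 2 * t ^ 2 * β t * F t ≤ En t := by
    intro t ht
    have h1 : 0 ≤ (θ * t * α t - 1 - θ) / 2 := by linarith [hξ t ht]
    simp only [hEn]
    have : 0 ≤ (1 / 2 * ‖x t - xs + (θ * t) • deriv x t‖ ^ 2
        + (θ * t * α t - 1 - θ) / 2 * ‖x t - xs‖ ^ 2)
      + (1 / 2 * ‖y t - ys + (θ * t) • deriv y t‖ ^ 2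
        + (θ * t * α t - 1 - θ) / 2 * ‖y t - ys‖ ^ 2) := by positivity
    linarith
  set c : ℝ := θ / 2 * (‖xs‖ ^ 2 + ‖ys‖ ^ 2) with hc
  have hc0 : 0 ≤ c := by positivity
  have hEnd : ∀ t > t₀, ∃ D, HasDerivAt En D t ∧ D ≤ c * (t * β t * ε t) := by
    intro t ht
    have htp : 0 < t := lt_trans ht₀ ht
    obtain ⟨hx1, hx2⟩ := hxd t ht
    obtain ⟨hy1, hy2⟩ := hyd t ht
    obtain ⟨ho1, ho2⟩ := hode t ht.le
    have ha := hαd t ht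
    have hb := hβd t ht
    have he := hεd t ht
    have hb0 := hβpos t ht.le
    have he0 := hεpos t ht.le
    have he' : deriv ε t ≤ 0 := by
      have h := hεanti.derivWithin_nonpos (x := t)
      rwa [derivWithin_of_mem_nhds (Ici_mem_nhds ht)] at h
    have hh1 := aux_half x (deriv x) α t θ _ (β t) _ _ xs hx1 hx2 ha ho1
    have hh2 := aux_half y (deriv y) α t θ _ (β t) _
      (-(K (x t + (θ * t) • deriv x t) - gradient g (y t) - ε t • y t)) ys hy1 hy2 ha
      (by rw [smul_neg, ← sub_eq_add_neg]; exact ho2)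
    have hfx := aux_comp f hf x _ t hx1
    have hgy := aux_comp g hg y _ t hy1
    have hKx : HasDerivAt (fun s => ⟪K (x s), ys⟫) ⟪K (deriv x t), ys⟫ t := by
      have := (K.hasFDerivAt.comp_hasDerivAt t hx1).inner ℝ (hasDerivAt_const t ys)
      simpa using this
    have hKy : HasDerivAt (fun s => ⟪K xs, y s⟫) ⟪K xs, deriv y t⟫ t := by
      have := (hasDerivAt_const t (K xs)).inner ℝ hy1
      simpa using this
    have hFd : HasDerivAt F (⟪gradient f (x t), deriv x t⟫ + ⟪K (deriv x t), ys⟫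
        - ⟪K xs, deriv y t⟫ + ⟪gradient g (y t), deriv y t⟫
        + (deriv ε t / 2 * (‖x t‖ ^ 2 + ‖y t‖ ^ 2)
          + ε t / 2 * (2 * ⟪x t, deriv x t⟫ + 2 * ⟪y t, deriv y t⟫))) t :=
      (((((hfx.sub_const (f xs)).add hKx).sub hKy).add hgy).sub_const (g ys)).add
        ((he.div_const 2).mul (hx1.norm_sq.add hy1.norm_sq))
    have hA : HasDerivAt (fun s => θ ^ 2 * s ^ 2 * β s)
        (θ ^ 2 * (2 * t) * β t + θ ^ 2 * t ^ 2 * deriv β t) t := by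
      have h := ((hasDerivAt_pow 2 t).const_mul (θ ^ 2)).mul hb
      refine h.congr_deriv ?_
      simp
    refine ⟨_, (hA.mul hFd).add (hh1.add hh2), ?_⟩
    have r1 := aux_grad_ineq f hf hfconv (x t) xs
    have r2 := aux_grad_ineq g hg hgconv (y t) ys
    have hbb : 2 * θ * β t + θ * t * deriv β t - β t ≤ 0 := by
      have := hβ' t ht.le
      rw [div_le_div_iff₀ hb0 (by positivity)] at this
      linarith
    have q1 : θ * t * (2 * θ * β t + θ * t * deriv β t - β t) * F t ≤ 0 :=
      mul_nonpos_of_nonpos_of_nonneg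
        (mul_nonpos_of_nonneg_of_nonpos (by positivity) hbb) (hF0 t ht.le)
    have q2 : θ ^ 2 * t ^ 2 * β t * (‖x t‖ ^ 2 + ‖y t‖ ^ 2) / 2 * deriv ε t ≤ 0 :=
      mul_nonpos_of_nonneg_of_nonpos (by positivity) he'
    have q3 : 0 ≤ θ * t * (θ * t * α t - 1 - θ) * (‖deriv x t‖ ^ 2 + ‖deriv y t‖ ^ 2) := by
      have := hξ t ht.le
      positivity
    have q4 : θ / 2 * (‖x t - xs‖ ^ 2 + ‖y t - ys‖ ^ 2)
        * (α t + t * deriv α t - t * β t * ε t) ≤ 0 :=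
      mul_nonpos_of_nonneg_of_nonpos (by positivity) (by linarith [hαε t ht.le])
    have q5 : 0 ≤ θ * t * β t * (f xs - f (x t) - ⟪gradient f (x t), xs - x t⟫) :=
      mul_nonneg (by positivity) (by linarith)
    have q6 : 0 ≤ θ * t * β t * (g ys - g (y t) - ⟪gradient g (y t), ys - y t⟫) :=
      mul_nonneg (by positivity) (by linarith)
    suffices hs : ∀ D, D = θ * t * (2 * θ * β t + θ * t * deriv β t - β t) * F t
        + θ ^ 2 * t ^ 2 * β t * (‖x t‖ ^ 2 + ‖y t‖ ^ 2) / 2 * deriv ε t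
        - θ * t * (θ * t * α t - 1 - θ) * (‖deriv x t‖ ^ 2 + ‖deriv y t‖ ^ 2)
        + θ / 2 * (‖x t - xs‖ ^ 2 + ‖y t - ys‖ ^ 2) * (α t + t * deriv α t - t * β t * ε t)
        - θ * t * β t * (f xs - f (x t) - ⟪gradient f (x t), xs - x t⟫)
        - θ * t * β t * (g ys - g (y t) - ⟪gradient g (y t), ys - y t⟫)
        + c * (t * β t * ε t) → D ≤ c * (t * β t * ε t) by
      apply hs
      simp only [hF, hc, map_add, map_smul, ← real_inner_self_eq_norm_sq, inner_add_right,
        inner_sub_right, inner_neg_right, inner_smul_right,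
        ContinuousLinearMap.adjoint_inner_right]
      simp only [inner_sub_left, map_sub, real_inner_comm]
      ring
    rintro D rfl
    linarith
  -- integrate
  set t₁ : ℝ := t₀ + 1 with ht₁
  set I : ℝ := ∫ t in Set.Ioi t₀, t * β t * ε t with hI
  have hbound : ∀ t ≥ t₁, En t ≤ En t₁ + c * I := by
    intro t ht
    choose! D hD hDle using hEnd
    have h := intervalIntegral.sub_le_integral_of_hasDeriv_right_of_le (g := En) (g' := D)
      (φ := fun s => c * (s * β s * ε s)) ht
      (fun s hs => (hD s (by linarith [hs.1])).continuousAt.continuousWithinAt)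
      (fun s hs => (hD s (by linarith [hs.1])).hasDerivWithinAt)
      ((hεint.mono_set (fun s hs => by
        simp only [Set.mem_Ioi]; linarith [hs.1])).const_mul c)
      (fun s hs => hDle s (by linarith [hs.1]))
    have h2 : ∫ s in t₁..t, c * (s * β s * ε s) ≤ c * I := by
      rw [intervalIntegral.integral_const_mul, intervalIntegral.integral_of_le ht]
      refine mul_le_mul_of_nonneg_left ?_ hc0
      refine setIntegral_mono_set hεint ?_ ?_
      · refine (ae_restrict_iff' measurableSet_Ioi).2 (Eventually.of_forall fun s hs => ?_)
        have hs' : t₀ < s := hs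
        have := hβpos s hs'.le
        have := hεpos s hs'.le
        have : 0 < s := lt_trans ht₀ hs'
        simp only [Pi.zero_apply]
        positivity
      · refine HasSubset.Subset.eventuallyLE (fun s hs => ?_)
        simp only [Set.mem_Ioi]
        linarith [hs.1]
    linarith
  set M : ℝ := En t₁ + c * I with hM
  have hFb : ∀ t ≥ t₁, t ^ 2 * β t * F t ≤ M / θ ^ 2 := by
    intro t ht
    rw [le_div_iff₀ (by positivity)]
    have := hEnlow t (by linarith)
    have := hbound t ht
    linarith
  have key1 : ∃ C, ∀ t ≥ t₀,
      ‖gradient f (x t) - gradient f xs‖ * (t * Real.sqrt (β t)) ≤ C := by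
    refine aux_bound t₀ t₁ L₁ (4 * L₁ * (M / θ ^ 2)) β hβC1.continuousOn hβpos x hxC.continuousOn xs _ ht₀
      (fun t ht => hfLip _ _) (fun t ht => ?_)
    have h0 : t₀ ≤ t := by linarith
    have h1 := hFb t ht
    have h2 := hFlow t h0
    have h3 : 1 / (4 * L₁) * ‖gradient f (x t) - gradient f xs‖ ^ 2 ≤ F t :=
      le_trans (le_add_of_nonneg_right (by positivity)) h2
    have hb := hβpos t h0
    rw [one_div_mul_eq_div, div_le_iff₀ (by positivity)] at h3
    calc _ ≤ (F t * (4 * L₁)) * (t ^ 2 * β t) := by gcongr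
      _ = 4 * L₁ * (t ^ 2 * β t * F t) := by ring
      _ ≤ _ := by gcongr
  have key2 : ∃ C, ∀ t ≥ t₀,
      ‖gradient g (y t) - gradient g ys‖ * (t * Real.sqrt (β t)) ≤ C := by
    refine aux_bound t₀ t₁ L₂ (4 * L₂ * (M / θ ^ 2)) β hβC1.continuousOn hβpos y hyC.continuousOn ys _ ht₀
      (fun t ht => hgLip _ _) (fun t ht => ?_)
    have h0 : t₀ ≤ t := by linarith
    have h1 := hFb t ht
    have h2 := hFlow t h0
    have h3 : 1 / (4 * L₂) * ‖gradient g (y t) - gradient g ys‖ ^ 2 ≤ F t :=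
      le_trans (le_add_of_nonneg_left (by positivity)) h2
    have hb := hβpos t h0
    rw [one_div_mul_eq_div, div_le_iff₀ (by positivity)] at h3
    calc _ ≤ (F t * (4 * L₂)) * (t ^ 2 * β t) := by gcongr
      _ = 4 * L₂ * (t ^ 2 * β t * F t) := by ring
      _ ≤ _ := by gcongr
  obtain ⟨C₁, hC₁⟩ := key1
  obtain ⟨C₂, hC₂⟩ := key2
  refine ⟨max (max C₁ C₂) 1, by positivity, fun t ht => ?_⟩
  have hb := hβpos t ht
  have htp : 0 < t := lt_of_lt_of_le ht₀ ht
  have hs : 0 < t * Real.sqrt (β t) := by positivity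
  rw [le_div_iff₀ hs, le_div_iff₀ hs]
  exact ⟨(hC₁ t ht).trans ((le_max_left _ _).trans (le_max_left _ _)),
    (hC₂ t ht).trans ((le_max_right _ _).trans (le_max_left _ _))⟩
end
end

section
/- Assume f : ℝⁿ → ℝ and g : ℝᵐ → ℝ are differentiable convex functions with ∇f L₁-Lipschitz and ∇g L₂-Lipschitz, α, β, ε : [t₀, ∞) → (0, ∞) are C¹, θ > 0 and t₀ > 0 are constants, K : ℝⁿ → ℝᵐ is linear with adjoint K*, α(t) ≥ (1 + θ)/(θ t), α(t) + tα′(t) ≤ tβ(t)ε(t), and (2θ − 1)β(t) + θ t β′(t) < 0 for all t ≥ t₀, ε is nonincreasing with ∫_{t₀}^∞ tβ(t)ε(t) dt < ∞, and lim_{t→∞} t²β(t) = +∞. Then for every twice continuously differentiable global solution (x(t), y(t)) of the dynamical system (15) and every saddle point (x*, y*) of L: ∫_{t₀}^∞ ((1 − 2θ)β(t) − θ t β′(t)) t (L(x(t), y*) − L(x*, y(t))) dt < +∞, ∫_{t₀}^∞ ((1 − 2θ)β(t) − θ t β′(t)) t ‖∇f(x(t)) − ∇f(x*)‖² dt < +∞,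 and ∫_{t₀}^∞ ((1 − 2θ)β(t) − θ t β′(t)) t ‖∇g(y(t)) − ∇g(y*)‖² dt < +∞. -/
open scoped RealInnerProductSpace
open MeasureTheory Filter Asymptotics

noncomputable section

lemma grad_comp {H : Type*} [NormedAddCommGroup H] [InnerProductSpace ℝ H] [CompleteSpace H]
    {f : H → ℝ} (hf : Differentiable ℝ f) {x : ℝ → H} {v : H} {t : ℝ} (hx : HasDerivAt x v t) :
    HasDerivAt (fun s => f (x s)) ⟪gradient f (x t), v⟫ t := by
  have h := (hf (x t)).hasFDerivAt.comp_hasDerivAt t hx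
  rw [inner_gradient_left]
  exact h

lemma convex_grad {H : Type*} [NormedAddCommGroup H] [InnerProductSpace ℝ H] [CompleteSpace H]
    {f : H → ℝ} (hf : Differentiable ℝ f) (hc : ConvexOn ℝ Set.univ f) (u v : H) :
    f u - f v ≤ ⟪gradient f u, u - v⟫ := by
  have hd : HasDerivAt (fun s : ℝ => u + s • (v - u)) (v - u) 0 := by
    simpa using ((hasDerivAt_id (0:ℝ)).smul_const (v - u)).const_add u
  have h1 := grad_comp hf hd
  have hc' : ConvexOn ℝ Set.univ (fun s : ℝ => f (u + s • (v - u))) := by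
    have := hc.comp_affineMap (AffineMap.lineMap u v)
    refine this.congr ?_
    intro s _
    simp [AffineMap.lineMap_apply, add_comm]
  have h2 := hc'.le_slope_of_hasDerivAt (Set.mem_univ 0) (Set.mem_univ 1) one_pos h1
  simp only [slope_def_field, zero_smul, one_smul, add_zero, sub_zero, div_one, add_sub_cancel] at h2
  have : u - v = -(v - u) := by abel
  rw [this, inner_neg_right]
  linarith

lemma descent {H : Type*} [NormedAddCommGroup H] [InnerProductSpace ℝ H] [CompleteSpace H]
    {f : H → ℝ} (hf : Differentiable ℝ f) {L : ℝ}
    (hL : ∀ u v, ‖gradient f u - gradient f v‖ ≤ L * ‖u - v‖) (u d : H) :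
    f (u + d) ≤ f u + ⟪gradient f u, d⟫ + L / 2 * ‖d‖ ^ 2 := by
  have hd : ∀ s : ℝ, HasDerivAt (fun s : ℝ => u + s • d) d s := fun s => by
    simpa using ((hasDerivAt_id s).smul_const d).const_add u
  have h1 : ∀ s : ℝ, HasDerivAt (fun s : ℝ => f (u + s • d) - (s * ⟪gradient f u, d⟫
      + L / 2 * s ^ 2 * ‖d‖ ^ 2))
      (⟪gradient f (u + s • d), d⟫ - (⟪gradient f u, d⟫ + L * s * ‖d‖ ^ 2)) s := fun s => by
    refine (grad_comp hf (hd s)).sub ?_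
    have a := (hasDerivAt_id s).mul_const ⟪gradient f u, d⟫
    have b := (((hasDerivAt_id s).pow 2).const_mul (L / 2)).mul_const (‖d‖ ^ 2)
    refine (a.add b).congr_deriv ?_
    simp only [id, Nat.cast_ofNat]
    ring
  have h2 := antitoneOn_of_hasDerivWithinAt_nonpos (convex_Icc (0:ℝ) 1)
    (fun s _ => (h1 s).continuousAt.continuousWithinAt)
    (fun s _ => (h1 s).hasDerivWithinAt) (by
      intro s hs
      rw [interior_Icc] at hs
      have e1 := real_inner_le_norm (gradient f (u + s • d) - gradient f u) d
      have e2 := hL (u + s • d) u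
      rw [inner_sub_left] at e1
      rw [add_sub_cancel_left, norm_smul, Real.norm_of_nonneg hs.1.le] at e2
      nlinarith [norm_nonneg d, mul_le_mul_of_nonneg_right e2 (norm_nonneg d)])
  have h3 := h2 (Set.left_mem_Icc.2 zero_le_one) (Set.right_mem_Icc.2 zero_le_one) zero_le_one
  simp only [zero_smul, one_smul, add_zero, zero_mul, one_mul, one_pow, mul_one, sub_zero, ne_eq,
    OfNat.ofNat_ne_zero, not_false_eq_true, zero_pow, mul_zero] at h3
  linarith

lemma min_coco {H : Type*} [NormedAddCommGroup H] [InnerProductSpace ℝ H] [CompleteSpace H]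
    {f : H → ℝ} (hf : Differentiable ℝ f) {L : ℝ} (hLp : 0 < L)
    (hL : ∀ u v, ‖gradient f u - gradient f v‖ ≤ L * ‖u - v‖) (c xs : H)
    (hmin : ∀ z, f xs + ⟪c, xs⟫ ≤ f z + ⟪c, z⟫) (z : H) :
    ‖gradient f z - gradient f xs‖ ^ 2 ≤ 2 * L * ((f z + ⟪c, z⟫) - (f xs + ⟪c, xs⟫)) := by
  have key : ∀ z, ‖gradient f z + c‖ ^ 2 ≤ 2 * L * ((f z + ⟪c, z⟫) - (f xs + ⟪c, xs⟫)) := by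
    intro z
    have h1 := descent hf hL z (-(L⁻¹) • (gradient f z + c))
    have h2 := hmin (z + -(L⁻¹) • (gradient f z + c))
    have e : ⟪gradient f z, gradient f z + c⟫ + ⟪c, gradient f z + c⟫
      = ‖gradient f z + c‖ ^ 2 := by
      rw [← inner_add_left, real_inner_self_eq_norm_sq]
    rw [inner_add_right, inner_smul_right] at h2
    rw [inner_smul_right, norm_smul, mul_pow, Real.norm_eq_abs, sq_abs] at h1
    generalize ‖gradient f z + c‖ ^ 2 = N at *
    have h3 : (f xs + ⟪c, xs⟫) ≤ f z + ⟪c, z⟫ + (-L⁻¹ * N + L / 2 * ((-L⁻¹) ^ 2 * N)) := by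
      rw [← e]; rw [← e] at h1; linarith
    have h4 : -L⁻¹ * N + L / 2 * ((-L⁻¹) ^ 2 * N) = - (N / (2 * L)) := by
      field_simp; ring
    rw [h4] at h3
    have h5 : N / (2 * L) ≤ (f z + ⟪c, z⟫) - (f xs + ⟪c, xs⟫) := by linarith
    rw [div_le_iff₀ (by positivity)] at h5
    linarith
  have h0 := key xs
  rw [sub_self, mul_zero] at h0
  have h0' : gradient f xs + c = 0 := by
    have : ‖gradient f xs + c‖ = 0 := by nlinarith [norm_nonneg (gradient f xs + c)]
    simpa using this
  have := key z
  rwa [show gradient f z - gradient f xs = gradient f z + c by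
    rw [eq_neg_of_add_eq_zero_left h0']; abel]

/-- Derivative of one half of the energy. -/
lemma half_energy {H : Type*} [NormedAddCommGroup H] [InnerProductSpace ℝ H]
    {x v : ℝ → H} {a p xs : H} {α β ε : ℝ → ℝ} {α' β' ε' θ t : ℝ}
    (hx : HasDerivAt x (v t) t) (hv : HasDerivAt v a t)
    (hα : HasDerivAt α α' t) (hβ : HasDerivAt β β' t) (hε : HasDerivAt ε ε' t)
    (ha : a = - (α t • v t) - β t • (p + ε t • x t)) :
    HasDerivAt (fun s => 1 / 2 * ‖(x s - xs) + (θ * s) • v s‖ ^ 2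
        + (θ * α s * s - θ - 1) / 2 * ‖x s - xs‖ ^ 2
        + θ ^ 2 * s ^ 2 * β s * (ε s / 2 * ‖x s‖ ^ 2))
      (-(θ * t * α t - 1 - θ) * θ * t * ‖v t‖ ^ 2
        + (θ * (α t + t * α') - θ * t * β t * ε t) / 2 * ‖x t - xs‖ ^ 2
        - θ * t * β t * (⟪x t - xs, p⟫ + θ * t * ⟪v t, p⟫)
        - θ * t * β t * ε t / 2 * (‖x t‖ ^ 2 - ‖xs‖ ^ 2)
        + θ ^ 2 * (2 * t * β t + t ^ 2 * β') * ε t / 2 * ‖x t‖ ^ 2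
        + θ ^ 2 * t ^ 2 * β t * ε' / 2 * ‖x t‖ ^ 2) t := by
  have hid := hasDerivAt_id t
  have d1 := (((hx.sub_const xs).add ((hid.const_mul θ).smul hv)).norm_sq).const_mul (1 / 2)
  have d2 := (((((hα.const_mul θ).mul hid).sub_const θ).sub_const 1).div_const 2).mul
    (hx.sub_const xs).norm_sq
  have d3 := (((hid.pow 2).const_mul (θ ^ 2)).mul hβ).mul ((hε.div_const 2).mul hx.norm_sq)
  refine ((d1.add d2).add d3).congr_deriv ?_
  subst ha
  simp only [Pi.add_apply, Pi.mul_apply, Pi.pow_apply, Pi.smul_apply', id,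
    ← real_inner_self_eq_norm_sq, inner_add_left, inner_add_right, inner_sub_left, inner_sub_right,
    inner_neg_right, inner_smul_left, inner_smul_right, RCLike.conj_to_real]
  rw [real_inner_comm (x t) xs, real_inner_comm (x t) (v t)]
  push_cast
  ring

lemma integ {t₀ : ℝ} {E E' F G : ℝ → ℝ} (hE : ContinuousOn E (Set.Ici t₀))
    (hF : ContinuousOn F (Set.Ici t₀)) (hE0 : ∀ t ≥ t₀, 0 ≤ E t) (hF0 : ∀ t > t₀, 0 ≤ F t)
    (hG0 : ∀ t > t₀, 0 ≤ G t)
    (hG : IntegrableOn G (Set.Ioi t₀)) (hd : ∀ t > t₀, HasDerivAt E (E' t) t)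
    (hle : ∀ t > t₀, E' t ≤ -F t + G t) : IntegrableOn F (Set.Ioi t₀) := by
  have hFi : ∀ T, IntegrableOn F (Set.Icc t₀ T) := fun T =>
    (hF.mono Set.Icc_subset_Ici_self).integrableOn_Icc
  have hGi : ∀ T, IntegrableOn G (Set.Icc t₀ T) := fun T => by
    rw [integrableOn_Icc_iff_integrableOn_Ioc]
    exact hG.mono_set Set.Ioc_subset_Ioi_self
  refine integrableOn_Ioi_of_intervalIntegral_norm_bounded (b := id) (l := atTop)
    (E t₀ + ∫ t in Set.Ioi t₀, G t) t₀
    (fun T => (hFi T).mono_set Set.Ioc_subset_Icc_self) tendsto_id ?_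
  filter_upwards [eventually_ge_atTop t₀] with T hT
  have h1 := intervalIntegral.sub_le_integral_of_hasDeriv_right_of_le hT
    (hE.mono Set.Icc_subset_Ici_self) (fun t ht => (hd t ht.1).hasDerivWithinAt)
    ((hFi T).neg.add (hGi T)) (fun t ht => hle t ht.1)
  have iF : IntervalIntegrable F volume t₀ T :=
    (intervalIntegrable_iff_integrableOn_Icc_of_le hT).2 (hFi T)
  have iG : IntervalIntegrable G volume t₀ T :=
    (intervalIntegrable_iff_integrableOn_Icc_of_le hT).2 (hGi T)
  have h2 : ∫ t in t₀..T, (-F + G) t = -(∫ t in t₀..T, F t) + ∫ t in t₀..T, G t := by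
    rw [← intervalIntegral.integral_neg]
    exact intervalIntegral.integral_add iF.neg iG
  have h3 : ∫ t in t₀..T, G t ≤ ∫ t in Set.Ioi t₀, G t := by
    rw [intervalIntegral.integral_of_le hT]
    refine setIntegral_mono_set hG ?_ Set.Ioc_subset_Ioi_self.eventuallyLE
    exact (ae_restrict_iff' measurableSet_Ioi).2 (ae_of_all _ fun t ht => hG0 t ht)
  have h4 : ∫ t in t₀..T, ‖F t‖ = ∫ t in t₀..T, F t := by
    rw [intervalIntegral.integral_of_le hT, intervalIntegral.integral_of_le hT]
    refine setIntegral_congr_fun measurableSet_Ioc fun t ht => ?_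
    exact Real.norm_of_nonneg (hF0 t ht.1)
  have h5 := hE0 T hT
  change ∫ t in t₀..T, ‖F t‖ ≤ _
  rw [h4]
  change E T - E t₀ ≤ ∫ t in t₀..T, (-F + G) t at h1
  rw [h2] at h1
  linarith

lemma d1_of {H : Type*} [NormedAddCommGroup H] [NormedSpace ℝ H] {t₀ t : ℝ} {u : ℝ → H}
    (h : ContDiffOn ℝ 1 u (Set.Ici t₀)) (ht : t₀ < t) : HasDerivAt u (deriv u t) t :=
  ((h.contDiffAt (Ici_mem_nhds ht)).differentiableAt one_ne_zero).hasDerivAt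

lemma d2_of {H : Type*} [NormedAddCommGroup H] [NormedSpace ℝ H] {t₀ t : ℝ} {u : ℝ → H}
    (h : ContDiffOn ℝ 2 u (Set.Ici t₀)) (ht : t₀ < t) :
    HasDerivAt u (derivWithin u (Set.Ici t₀) t) t ∧
    HasDerivAt (derivWithin u (Set.Ici t₀)) (deriv (deriv u) t) t := by
  constructor
  · rw [derivWithin_of_mem_nhds (Ici_mem_nhds ht)]
    exact d1_of (h.of_le (by norm_num)) ht
  · have h1 : ContDiffOn ℝ 1 (deriv u) (Set.Ioi t₀) :=
      (h.mono Set.Ioi_subset_Ici_self).deriv_of_isOpen isOpen_Ioi (by norm_num)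
    have h2 := ((h1.contDiffAt (Ioi_mem_nhds ht)).differentiableAt one_ne_zero).hasDerivAt
    refine h2.congr_of_eventuallyEq ?_
    filter_upwards [Ioi_mem_nhds ht] with s hs
    exact derivWithin_of_mem_nhds (Ici_mem_nhds hs)

lemma cont_grad {H : Type*} [NormedAddCommGroup H] [InnerProductSpace ℝ H] [CompleteSpace H]
    {f : H → ℝ} {L : ℝ} (hLp : 0 < L)
    (hL : ∀ u v, ‖gradient f u - gradient f v‖ ≤ L * ‖u - v‖) : Continuous (gradient f) := by
  refine (LipschitzWith.of_dist_le_mul (K := ⟨L, hLp.le⟩) fun u v => ?_).continuous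
  rw [dist_eq_norm, dist_eq_norm]
  exact hL u v

/-- Theorem 3.1, integral estimates: if moreover
`(2θ − 1)β(t) + θtβ′(t) < 0` for all `t ≥ t₀`, then the weighted integrals of the
primal-dual gap and of the gradient residuals along any solution of (15) are finite. -/
theorem stmt_13 {n m : ℕ} (t₀ θ L₁ L₂ : ℝ) (ht₀ : 0 < t₀) (hθ : 0 < θ)
    (hL₁ : 0 < L₁) (hL₂ : 0 < L₂)
    (f : EuclideanSpace ℝ (Fin n) → ℝ) (g : EuclideanSpace ℝ (Fin m) → ℝ)
    (hf : Differentiable ℝ f) (hg : Differentiable ℝ g)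
    (hfconv : ConvexOn ℝ Set.univ f) (hgconv : ConvexOn ℝ Set.univ g)
    (K : EuclideanSpace ℝ (Fin n) →L[ℝ] EuclideanSpace ℝ (Fin m))
    (α β ε : ℝ → ℝ)
    (hαC1 : ContDiffOn ℝ 1 α (Set.Ici t₀)) (hβC1 : ContDiffOn ℝ 1 β (Set.Ici t₀))
    (hεC1 : ContDiffOn ℝ 1 ε (Set.Ici t₀))
    (hαpos : ∀ t ≥ t₀, 0 < α t) (hβpos : ∀ t ≥ t₀, 0 < β t) (hεpos : ∀ t ≥ t₀, 0 < ε t)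
    (hα : ∀ t ≥ t₀, (1 + θ) / (θ * t) ≤ α t)
    (hfLip : ∀ u v, ‖gradient f u - gradient f v‖ ≤ L₁ * ‖u - v‖)
    (hgLip : ∀ u v, ‖gradient g u - gradient g v‖ ≤ L₂ * ‖u - v‖)
    (hαε : ∀ t ≥ t₀, α t + t * deriv α t ≤ t * β t * ε t)
    (hβ'' : ∀ t ≥ t₀, (2 * θ - 1) * β t + θ * t * deriv β t < 0)
    (hεanti : AntitoneOn ε (Set.Ici t₀))
    (hεint : IntegrableOn (fun t => t * β t * ε t) (Set.Ioi t₀))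
    (hβtop : Tendsto (fun t => t ^ 2 * β t) atTop atTop)
    (hΩ : ∃ p : EuclideanSpace ℝ (Fin n) × EuclideanSpace ℝ (Fin m),
      IsSaddle f g K p.1 p.2)
    (x : ℝ → EuclideanSpace ℝ (Fin n)) (y : ℝ → EuclideanSpace ℝ (Fin m))
    (hsol : IsSol t₀ θ f g K α β ε x y)
    (xs : EuclideanSpace ℝ (Fin n)) (ys : EuclideanSpace ℝ (Fin m))
    (hsaddle : IsSaddle f g K xs ys) :
    IntegrableOn
      (fun t => ((1 - 2 * θ) * β t - θ * t * deriv β t) * t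
        * (Lag f g K (x t) ys - Lag f g K xs (y t))) (Set.Ioi t₀) ∧
    IntegrableOn
      (fun t => ((1 - 2 * θ) * β t - θ * t * deriv β t) * t
        * ‖gradient f (x t) - gradient f xs‖ ^ 2) (Set.Ioi t₀) ∧
    IntegrableOn
      (fun t => ((1 - 2 * θ) * β t - θ * t * deriv β t) * t
        * ‖gradient g (y t) - gradient g ys‖ ^ 2) (Set.Ioi t₀) := by
  obtain ⟨hxC, hyC, heq⟩ := hsol
  have hU := uniqueDiffOn_Ici t₀
  set v := derivWithin x (Set.Ici t₀) with hvdef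
  set w := derivWithin y (Set.Ici t₀) with hwdef
  set b := derivWithin β (Set.Ici t₀) with hbdef
  have hvC : ContinuousOn v (Set.Ici t₀) := hxC.continuousOn_derivWithin hU (by norm_num)
  have hwC : ContinuousOn w (Set.Ici t₀) := hyC.continuousOn_derivWithin hU (by norm_num)
  have hbC : ContinuousOn b (Set.Ici t₀) := hβC1.continuousOn_derivWithin hU le_rfl
  have hv : ∀ t > t₀, v t = deriv x t := fun t ht => derivWithin_of_mem_nhds (Ici_mem_nhds ht)
  have hw : ∀ t > t₀, w t = deriv y t := fun t ht => derivWithin_of_mem_nhds (Ici_mem_nhds ht)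
  have hb : ∀ t > t₀, b t = deriv β t := fun t ht => derivWithin_of_mem_nhds (Ici_mem_nhds ht)
  have hxc := hxC.continuousOn
  have hyc := hyC.continuousOn
  have hαc := hαC1.continuousOn
  have hβc := hβC1.continuousOn
  have hεc := hεC1.continuousOn
  have hfc := hf.continuous
  have hgc := hg.continuous
  have hgf := cont_grad hL₁ hfLip
  have hgg := cont_grad hL₂ hgLip
  -- the gap controls the residuals
  have hres1 : ∀ z, ‖gradient f z - gradient f xs‖ ^ 2 ≤
      2 * L₁ * (Lag f g K z ys - Lag f g K xs ys) := by
    intro z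
    have := min_coco hf hL₁ hfLip (ContinuousLinearMap.adjoint K ys) xs (by
      intro z
      have := (hsaddle z ys).2
      simp only [Lag] at this
      rw [ContinuousLinearMap.adjoint_inner_left, ContinuousLinearMap.adjoint_inner_left,
        real_inner_comm, real_inner_comm (K z)]
      linarith) z
    rw [ContinuousLinearMap.adjoint_inner_left, ContinuousLinearMap.adjoint_inner_left,
        real_inner_comm, real_inner_comm (K xs)] at this
    refine this.trans_eq ?_
    simp only [Lag]
    ring
  have hres2 : ∀ z, ‖gradient g z - gradient g ys‖ ^ 2 ≤
      2 * L₂ * (Lag f g K xs ys - Lag f g K xs z) := by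
    intro z
    have := min_coco hg hL₂ hgLip (-(K xs)) ys (by
      intro z
      have := (hsaddle xs z).1
      simp only [Lag] at this
      rw [inner_neg_left, inner_neg_left]
      linarith) z
    rw [inner_neg_left, inner_neg_left] at this
    refine this.trans_eq ?_
    simp only [Lag]
    ring
  have hgx : ∀ z, 0 ≤ Lag f g K z ys - Lag f g K xs ys := fun z => by
    linarith [(hsaddle z ys).2]
  have hgy : ∀ z, 0 ≤ Lag f g K xs ys - Lag f g K xs z := fun z => by
    linarith [(hsaddle xs z).1]
  have hgap0 : ∀ t, 0 ≤ Lag f g K (x t) ys - Lag f g K xs (y t) := fun t => by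
    linarith [hgx (x t), hgy (y t)]
  have hgapC : ContinuousOn (fun t => Lag f g K (x t) ys - Lag f g K xs (y t)) (Set.Ici t₀) := by
    unfold Lag
    have := K.continuous
    fun_prop
  have hW0 : ∀ t > t₀, 0 ≤ ((1 - 2 * θ) * β t - θ * t * b t) * t := fun t ht => by
    have h1 := hβ'' t ht.le
    rw [hb t ht]
    exact mul_nonneg (by linarith) (ht₀.trans ht).le
  have hWC : ContinuousOn (fun t => ((1 - 2 * θ) * β t - θ * t * b t) * t) (Set.Ici t₀) := by
    fun_prop
  -- main estimate
  have main : IntegrableOn (fun t => θ * (((1 - 2 * θ) * β t - θ * t * b t) * t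
        * (Lag f g K (x t) ys - Lag f g K xs (y t)))) (Set.Ioi t₀) := by
    let P : ℝ → EuclideanSpace ℝ (Fin n) := fun t =>
      gradient f (x t) + (ContinuousLinearMap.adjoint K) (y t + (θ * t) • w t)
    let Q : ℝ → EuclideanSpace ℝ (Fin m) := fun t => gradient g (y t) - K (x t + (θ * t) • v t)
    have hX := fun t (ht : t > t₀) => half_energy (θ := θ) (xs := xs) (p := P t)
      (d2_of hxC ht).1 (d2_of hxC ht).2 (d1_of hαC1 ht) (d1_of hβC1 ht) (d1_of hεC1 ht) (by
        have := (heq t ht.le).1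
        simp only [P]
        rw [← hvdef, hv t ht, hw t ht]
        rw [← sub_eq_zero, ← this]
        module)
    have hY := fun t (ht : t > t₀) => half_energy (θ := θ) (xs := ys) (p := Q t)
      (d2_of hyC ht).1 (d2_of hyC ht).2 (d1_of hαC1 ht) (d1_of hβC1 ht) (d1_of hεC1 ht) (by
        have := (heq t ht.le).2
        simp only [Q]
        rw [← hwdef, hv t ht, hw t ht]
        rw [← sub_eq_zero, ← this]
        module)
    have hGd := fun t (ht : t > t₀) => show HasDerivAt
        (fun s => Lag f g K (x s) ys - Lag f g K xs (y s))
        (⟪gradient f (x t), v t⟫ + ⟪K (v t), ys⟫ - (⟪K xs, w t⟫ - ⟪gradient g (y t), w t⟫)) t by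
      have hx1 := (d2_of hxC ht).1
      have hy1 := (d2_of hyC ht).1
      have k1 : HasDerivAt (fun s => K (x s)) (K (v t)) t := K.hasFDerivAt.comp_hasDerivAt t hx1
      have k2 := k1.inner ℝ (hasDerivAt_const t ys)
      have k3 := (hasDerivAt_const t (K xs)).inner ℝ hy1
      have k4 := (((grad_comp hf hx1).add k2).sub_const (g ys)).sub
        ((k3.const_add (f xs)).sub (grad_comp hg hy1))
      refine k4.congr_deriv ?_
      simp [v, w]
    have hGd2 := fun t (ht : t > t₀) =>
      ((((hasDerivAt_id t).pow 2).const_mul (θ ^ 2)).mul (d1_of hβC1 ht)).mul (hGd t ht)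
    refine integ (G := fun t => θ * (‖xs‖ ^ 2 + ‖ys‖ ^ 2) / 2 * (t * β t * ε t)) ?_ ?_ ?_ ?_ ?_
      (hεint.const_mul _) (fun t ht => ((hGd2 t ht).add (hX t ht)).add (hY t ht)) ?_
    · simp only [← hvdef, ← hwdef]
      refine ContinuousOn.add (ContinuousOn.add (ContinuousOn.mul ?_ hgapC) ?_) ?_
      · have : ContinuousOn (fun s : ℝ => θ ^ 2 * s ^ 2 * β s) (Set.Ici t₀) := by fun_prop
        exact this
      · fun_prop
      · fun_prop
    · exact continuousOn_const.mul (hWC.mul hgapC)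
    · intro t ht
      have htp : 0 < t := ht₀.trans_le ht
      have h1 := hα t ht
      rw [div_le_iff₀ (by positivity)] at h1
      have h2 : 0 ≤ θ * α t * t - θ - 1 := by linarith
      have h3 := hβpos t ht
      have h4 := hεpos t ht
      have h5 := hgap0 t
      simp only [Pi.add_apply, Pi.mul_apply, Pi.pow_apply, id]
      positivity
    · intro t ht
      exact mul_nonneg hθ.le (mul_nonneg (hW0 t ht) (hgap0 t))
    · intro t ht
      have htp : 0 < t := ht₀.trans ht
      have h3 := hβpos t ht.le
      have h4 := hεpos t ht.le
      positivity
    · intro t ht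
      have htp : 0 < t := ht₀.trans ht
      have h1 := hα t ht.le
      rw [div_le_iff₀ (by positivity)] at h1
      have h3 := hβpos t ht.le
      have h4 := hεpos t ht.le
      have h5 := hgap0 t
      have h6 := hαε t ht.le
      have h7 := hβ'' t ht.le
      have h8 : deriv ε t ≤ 0 := by
        rw [← derivWithin_of_mem_nhds (Ici_mem_nhds ht)]
        exact hεanti.derivWithin_nonpos
      have c1 := convex_grad hf hfconv (x t) xs
      have c2 := convex_grad hg hgconv (y t) ys
      rw [hb t ht]
      simp only [← hvdef, ← hwdef, P, Q, Pi.mul_apply, Pi.pow_apply, id]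
      -- nonnegative quantities
      have n1 : 0 ≤ (θ * t * α t - 1 - θ) * θ * t * (‖v t‖ ^ 2 + ‖w t‖ ^ 2) := by
        have : 0 ≤ θ * t * α t - 1 - θ := by linarith
        positivity
      have n2 : 0 ≤ θ * (t * β t * ε t - (α t + t * deriv α t)) / 2
          * (‖x t - xs‖ ^ 2 + ‖y t - ys‖ ^ 2) := by
        have : 0 ≤ t * β t * ε t - (α t + t * deriv α t) := by linarith
        positivity
      have n3 : 0 ≤ θ * t * (-((2 * θ - 1) * β t + θ * t * deriv β t)) * ε t / 2
          * (‖x t‖ ^ 2 + ‖y t‖ ^ 2) := by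
        have : 0 ≤ -((2 * θ - 1) * β t + θ * t * deriv β t) := by linarith
        positivity
      have n4 : 0 ≤ θ ^ 2 * t ^ 2 * β t * (-deriv ε t) / 2 * (‖x t‖ ^ 2 + ‖y t‖ ^ 2) := by
        have : 0 ≤ -deriv ε t := by linarith
        positivity
      have n5 : 0 ≤ θ * t * β t * ((⟪gradient f (x t), x t - xs⟫ - (f (x t) - f xs))
          + (⟪gradient g (y t), y t - ys⟫ - (g (y t) - g ys))) := by
        have : 0 ≤ (⟪gradient f (x t), x t - xs⟫ - (f (x t) - f xs))
          + (⟪gradient g (y t), y t - ys⟫ - (g (y t) - g ys)) := by linarith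
        positivity
      rw [← sub_nonneg]
      refine (add_nonneg (add_nonneg (add_nonneg (add_nonneg n1 n2) n3) n4) n5).trans_eq ?_
      have e1 : ⟪x t - xs, gradient f (x t)⟫ = ⟪gradient f (x t), x t - xs⟫ := real_inner_comm _ _
      have e2 : ⟪y t - ys, gradient g (y t)⟫ = ⟪gradient g (y t), y t - ys⟫ := real_inner_comm _ _
      have e3 : ⟪v t, gradient f (x t)⟫ = ⟪gradient f (x t), v t⟫ := real_inner_comm _ _
      have e4 : ⟪w t, gradient g (y t)⟫ = ⟪gradient g (y t), w t⟫ := real_inner_comm _ _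
      rw [inner_add_right (x t - xs), inner_add_right (v t), inner_sub_right (y t - ys),
        inner_sub_right (w t), e1, e2, e3, e4]
      simp only [ContinuousLinearMap.adjoint_inner_right]
      rw [real_inner_comm _ (y t - ys), real_inner_comm _ (w t)]
      simp only [Lag, map_add, map_sub, map_smul, inner_add_left, inner_add_right, inner_sub_left,
        inner_smul_left, inner_smul_right, RCLike.conj_to_real,
        inner_sub_right (K (x t)), inner_sub_right (K (v t))]
      push_cast
      ring
  have main' : IntegrableOn (fun t => ((1 - 2 * θ) * β t - θ * t * b t) * t
        * (Lag f g K (x t) ys - Lag f g K xs (y t))) (Set.Ioi t₀) := by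
    refine IntegrableOn.congr_fun (main.const_mul θ⁻¹) (fun t _ => ?_) measurableSet_Ioi
    field_simp
  -- domination
  have dom : ∀ (N : ℝ → ℝ) (C : ℝ), ContinuousOn N (Set.Ici t₀) → (∀ t, 0 ≤ N t) →
      (∀ t, N t ≤ C * (Lag f g K (x t) ys - Lag f g K xs (y t))) →
      IntegrableOn (fun t => ((1 - 2 * θ) * β t - θ * t * deriv β t) * t * N t) (Set.Ioi t₀) := by
    intro N C hN hN0 hNC
    have h1 : IntegrableOn (fun t => ((1 - 2 * θ) * β t - θ * t * b t) * t * N t)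
        (Set.Ioi t₀) := by
      refine (main'.const_mul C).mono'
        (((hWC.mul hN).mono Set.Ioi_subset_Ici_self).aestronglyMeasurable measurableSet_Ioi) ?_
      refine (ae_restrict_iff' measurableSet_Ioi).2 (ae_of_all _ fun t ht => ?_)
      rw [Real.norm_of_nonneg (mul_nonneg (hW0 t ht) (hN0 t))]
      refine (mul_le_mul_of_nonneg_left (hNC t) (hW0 t ht)).trans_eq ?_
      ring
    refine h1.congr_fun (fun t ht => ?_) measurableSet_Ioi
    simp only [hb t ht]
  refine ⟨dom _ 1 hgapC hgap0 (fun t => by rw [one_mul]), dom _ (2 * L₁) ?_ ?_ ?_,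
    dom _ (2 * L₂) ?_ ?_ ?_⟩
  · exact ((hgf.comp_continuousOn hxc).sub continuousOn_const).norm.pow 2
  · intro t; positivity
  · intro t
    refine (hres1 (x t)).trans (mul_le_mul_of_nonneg_left ?_ (by positivity))
    linarith [hgy (y t)]
  · exact ((hgg.comp_continuousOn hyc).sub continuousOn_const).norm.pow 2
  · intro t; positivity
  · intro t
    refine (hres2 (y t)).trans (mul_le_mul_of_nonneg_left ?_ (by positivity))
    linarith [hgx (x t)]
end
end

section
/- Assume f : ℝⁿ → ℝ and g : ℝᵐ → ℝ are differentiable convex functions with ∇f L₁-Lipschitz and ∇g L₂-Lipschitz, α, β : [t₀, ∞) → (0, ∞) are C¹, ε : [t₀, ∞) → (0, ∞) is C¹ and nonincreasing, θ > 0 and t₀ > 0 are constants, K : ℝⁿ → ℝᵐ is linear with adjoint K*, α(t) ≥ (1 + θ)/(θ t), β′(t)/β(t) ≤ (1 − 2θ)/(θ t), and α(t) + tα′(t) ≤ tβ(t)ε(t) for all t ≥ t₀, ∫_{t₀}^∞ (β(t)ε(t)/t) dt < ∞, liminf_{t→∞} β(t) ≠ 0, and lim_{t→∞} t²β(t)ε(t)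 = +∞. Let (x(t), y(t)) be a twice continuously differentiable global solution of the dynamical system (15), and let (x̂*, ŷ*) be the element of minimal Euclidean norm of the saddle point set Ω (the projection of 0 onto Ω). Then liminf_{t→∞} ‖(x(t), y(t)) − (x̂*, ŷ*)‖ = 0. Moreover, if there exists T ≥ t₀ such that for all t ≥ T the point (x(t), y(t)) lies in the open ball B(0, ‖(x̂*, ŷ*)‖), or for all t ≥ T it lies in its complement, then lim_{t→∞} ‖(x(t), y(t)) − (x̂*, ŷ*)‖ = 0. -/
open scoped RealInnerProductSpace
open MeasureTheory Filter Asymptotics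

noncomputable section

section aux
variable {X : Type*} [NormedAddCommGroup X] [InnerProductSpace ℝ X] [CompleteSpace X]

lemma comp_grad {f : X → ℝ} (hf : Differentiable ℝ f) {x : ℝ → X} {xd : X} {t : ℝ}
    (hx : HasDerivAt x xd t) : HasDerivAt (fun s => f (x s)) ⟪gradient f (x t), xd⟫ t := by
  have h1 := ((hf (x t)).hasFDerivAt).comp_hasDerivAt t hx
  rw [inner_gradient_left]
  exact h1

lemma convex_grad_s17 {f : X → ℝ} (hf : Differentiable ℝ f) (hc : ConvexOn ℝ Set.univ f) (a b : X) :
    f a + ⟪gradient f a, b - a⟫ ≤ f b := by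
  have h1 : ConvexOn ℝ Set.univ (fun s : ℝ => f (AffineMap.lineMap a b s)) :=
    hc.comp_affineMap (AffineMap.lineMap a b)
  have h2 : HasDerivAt (fun s : ℝ => f (AffineMap.lineMap a b s)) ⟪gradient f a, b - a⟫ 0 := by
    have := comp_grad hf (x := fun s : ℝ => AffineMap.lineMap a b s) (t := 0)
      (AffineMap.hasDerivAt_lineMap)
    simpa using this
  have h3 := h1.le_slope_of_hasDerivAt (Set.mem_univ 0) (Set.mem_univ 1) one_pos h2
  simp only [slope_def_field, AffineMap.lineMap_apply_zero, AffineMap.lineMap_apply_one] at h3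
  linarith

lemma bregman {f : X → ℝ} (hf : Differentiable ℝ f) (hc : ConvexOn ℝ Set.univ f) {L : ℝ}
    (hL : 0 < L) (hLip : ∀ u v, ‖gradient f u - gradient f v‖ ≤ L * ‖u - v‖) (a b : X) :
    ‖gradient f b - gradient f a‖ ^ 2 ≤ 4 * L * (f b - f a - ⟪gradient f a, b - a⟫) := by
  set d : X := gradient f b - gradient f a with hd
  set z : X := b - (1 / (2 * L)) • d with hz
  have h1 := convex_grad_s17 hf hc a z
  have h2 := convex_grad_s17 hf hc z b
  have h3 := hLip b z
  have hbz : b - z = (1 / (2 * L)) • d := by rw [hz]; abel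
  have h4 : ⟪gradient f b - gradient f z, b - z⟫ ≤ L * ‖b - z‖ ^ 2 := by
    calc _ ≤ ‖gradient f b - gradient f z‖ * ‖b - z‖ := real_inner_le_norm _ _
      _ ≤ (L * ‖b - z‖) * ‖b - z‖ := by gcongr
      _ = _ := by ring
  have hza : z - a = (b - a) - (1 / (2 * L)) • d := by rw [hz]; abel
  rw [hbz] at h2 h4
  rw [hza] at h1
  rw [norm_smul, mul_pow, inner_sub_left, inner_smul_right, inner_smul_right] at h4
  rw [inner_smul_right] at h2
  rw [inner_sub_right, inner_smul_right] at h1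
  have h5 : ⟪gradient f b, d⟫ - ⟪gradient f a, d⟫ = ‖d‖ ^ 2 := by
    rw [← inner_sub_left, ← hd, real_inner_self_eq_norm_sq]
  have h6 : ‖(1 / (2 * L))‖ ^ 2 = 1 / (4 * L ^ 2) := by
    rw [Real.norm_eq_abs, sq_abs]; ring
  rw [h6] at h4
  have h7 : (1 / (2 * L)) * ‖d‖ ^ 2 - L * (1 / (4 * L ^ 2) * ‖d‖ ^ 2)
      ≤ f b - f a - ⟪gradient f a, b - a⟫ := by
    rw [← h5] at h4 ⊢
    linarith
  have h8 : (1 / (2 * L)) * ‖d‖ ^ 2 - L * (1 / (4 * L ^ 2) * ‖d‖ ^ 2) = ‖d‖ ^ 2 / (4 * L) := by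
    field_simp; ring
  rw [h8, div_le_iff₀ (by positivity)] at h7
  linarith

/-- One half of the Lyapunov energy. -/
def halfE (θ : ℝ) (f : X → ℝ) (xs : X) (α β ε : ℝ → ℝ) (x xd : ℝ → X) (t : ℝ) : ℝ :=
  θ ^ 2 * t ^ 2 * β t *
        (f (x t) - f xs - ⟪gradient f xs, x t - xs⟫ + ε t / 2 * ‖x t‖ ^ 2)
        + 1 / 2 * ‖x t - xs + (θ * t) • xd t‖ ^ 2
        + (θ * (t * α t) - θ - 1) / 2 * ‖x t - xs‖ ^ 2

lemma half_energy_s17 {f : X → ℝ} (hf : Differentiable ℝ f) (hc : ConvexOn ℝ Set.univ f)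
    {x xd : ℝ → X} {xdd k xs : X} {α β ε : ℝ → ℝ} {α' β' ε' θ t : ℝ} (ht : 0 < t) (hθ : 0 < θ)
    (hx : HasDerivAt x (xd t) t) (hxd : HasDerivAt xd xdd t)
    (hα : HasDerivAt α α' t) (hβ : HasDerivAt β β' t) (hε : HasDerivAt ε ε' t)
    (hβpos : 0 < β t)
    (hαε : α t + t * α' ≤ t * β t * ε t)
    (heq : xdd + α t • xd t + β t • (gradient f (x t) - gradient f xs + ε t • x t + k) = 0) :
    ∃ e' : ℝ, HasDerivAt (halfE θ f xs α β ε x xd) e' t ∧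
      e' ≤ θ ^ 2 * (2 * t * β t + t ^ 2 * β') *
          (f (x t) - f xs - ⟪gradient f xs, x t - xs⟫ + ε t / 2 * ‖x t‖ ^ 2)
        + θ ^ 2 * t ^ 2 * β t * (ε' / 2 * ‖x t‖ ^ 2)
        - θ * t * β t * (f (x t) - f xs - ⟪gradient f xs, x t - xs⟫
            + ε t / 2 * (‖x t‖ ^ 2 - ‖xs‖ ^ 2))
        - (θ * (t * α t) - θ - 1) * θ * t * ‖xd t‖ ^ 2
        - θ * t * β t * ⟪x t - xs + (θ * t) • xd t, k⟫ := by
  have hu : HasDerivAt (fun s => x s - xs) (xd t) t := hx.sub_const xs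
  have ht' : HasDerivAt (fun s : ℝ => s) 1 t := hasDerivAt_id t
  have hv : HasDerivAt (fun s => x s - xs + (θ * s) • xd s)
      (xd t + ((θ * t) • xdd + (θ * 1) • xd t)) t :=
    hu.add ((ht'.const_mul θ).smul hxd)
  have hD := (((comp_grad hf hx).sub_const (f xs)).sub
    ((hasDerivAt_const t (gradient f xs)).inner ℝ hu)).add ((hε.div_const 2).mul hx.norm_sq)
  have hR := ((ht'.pow 2).const_mul (θ ^ 2)).mul hβ
  have hb := ((((ht'.mul hα).const_mul θ).sub_const θ).sub_const 1).div_const 2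
  have hE := ((hR.mul hD).add (hv.norm_sq.const_mul (1 / 2))).add (hb.mul hu.norm_sq)
  refine ⟨_, hE, ?_⟩
  have hcv := convex_grad_s17 hf hc (x t) xs
  have hxdd : xdd = -(α t • xd t) - β t • (gradient f (x t) - gradient f xs + ε t • x t + k) := by
    rw [← sub_eq_zero, ← heq]; abel
  have hux : ‖x t - xs‖ ^ 2 = ‖x t‖ ^ 2 - 2 * ⟪x t, xs⟫ + ‖xs‖ ^ 2 := by
    rw [norm_sub_sq_real]
  have h1 : θ * t * β t * (f (x t) - f xs) ≤ θ * t * β t * ⟪gradient f (x t), x t - xs⟫ := by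
    apply mul_le_mul_of_nonneg_left _ (by positivity)
    rw [← neg_sub (x t) xs, inner_neg_right] at hcv
    linarith
  have h2 : θ * (α t + t * α') * ‖x t - xs‖ ^ 2 ≤ θ * (t * β t * ε t) * ‖x t - xs‖ ^ 2 := by
    gcongr
  have hxu : ⟪x t, x t - xs⟫ = ‖x t‖ ^ 2 - ⟪x t, xs⟫ := by
    rw [inner_sub_right, real_inner_self_eq_norm_sq]
  have h3 : ‖x t‖ ^ 2 - ‖xs‖ ^ 2 + ‖x t - xs‖ ^ 2 = 2 * ⟪x t, x t - xs⟫ := by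
    rw [hxu, hux]; ring
  subst hxdd
  simp only [Pi.mul_apply, Pi.add_apply, Pi.sub_apply, Pi.pow_apply]
  generalize hU : x t - xs = U at *
  generalize hG : gradient f (x t) = G at *
  generalize hG' : gradient f xs = G' at *
  simp only [inner_add_left, inner_add_right, inner_sub_right, inner_neg_right,
    inner_smul_left, inner_smul_right, inner_zero_left, real_inner_self_eq_norm_sq,
    RCLike.conj_to_real]
  have c2 : ⟪xd t, x t⟫ = ⟪x t, xd t⟫ := real_inner_comm _ _
  have c3 : ⟪xd t, G⟫ = ⟪G, xd t⟫ := real_inner_comm _ _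
  have c4 : ⟪xd t, G'⟫ = ⟪G', xd t⟫ := real_inner_comm _ _
  have c5 : ⟪U, x t⟫ = ⟪x t, U⟫ := real_inner_comm _ _
  have c6 : ⟪U, G⟫ = ⟪G, U⟫ := real_inner_comm _ _
  have c7 : ⟪U, G'⟫ = ⟪G', U⟫ := real_inner_comm _ _
  rw [c2, c3, c4, c5, c6, c7]
  have h4 : θ * t * β t * ε t * (‖x t‖ ^ 2 - ‖xs‖ ^ 2 + ‖U‖ ^ 2)
    = θ * t * β t * ε t * (2 * ⟪x t, U⟫) := by rw [h3]
  push_cast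
  ring_nf at h1 h2 h4 ⊢
  linarith
end aux

lemma fin_decay {X : Type*} [NormedAddCommGroup X] [NormedSpace ℝ X] {p : ℝ} (hp : 0 < p)
    {h h' : ℝ → X} {B B' e : ℝ → ℝ} {T : ℝ} (hT : 0 < T)
    (hh : ∀ t ≥ T, HasDerivAt h (h' t) t) (hB : ∀ t ≥ T, HasDerivAt B (B' t) t)
    (hle : ∀ t ≥ T, ‖h' t‖ ≤ B' t + p * t ^ (p - 1) * e t)
    (he : Tendsto e atTop (nhds 0)) (hB0 : Tendsto (fun t => t ^ (-p) * B t) atTop (nhds 0)) :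
    Tendsto (fun t => t ^ (-p) • h t) atTop (nhds 0) := by
  rw [Metric.tendsto_atTop'] 
  intro δ hδ
  have he' : ∀ᶠ t in atTop, e t ≤ δ / 4 := he.eventually_le_const (by positivity)
  obtain ⟨S, hS⟩ := (he'.and (eventually_ge_atTop T)).exists_forall_of_atTop
  have hST : T ≤ S := (hS S le_rfl).2
  have hSpos : 0 < S := hT.trans_le hST
  have key : ∀ t ≥ S, ‖h t‖ ≤ ‖h S‖ - B S + B t + δ / 4 * t ^ p := by
    intro t ht
    have hd : ∀ s ≥ S, HasDerivAt (fun s => ‖h S‖ - B S + B s + δ / 4 * s ^ p)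
        (B' s + δ / 4 * (p * s ^ (p - 1))) s := by
      intro s hs
      have h1 := (Real.hasDerivAt_rpow_const (x := s) (p := p)
        (Or.inl (hSpos.trans_le hs).ne')).const_mul (δ / 4)
      exact ((hB s (hST.trans hs)).const_add _).add h1
    refine image_norm_le_of_norm_deriv_right_le_deriv_boundary' (a := S) (b := t) (f' := h')
      (B := fun s => ‖h S‖ - B S + B s + δ / 4 * s ^ p)
      (B' := fun s => B' s + δ / 4 * (p * s ^ (p - 1)))
      (fun s hs => (hh s (hST.trans hs.1)).continuousAt.continuousWithinAt)
      (fun s hs => (hh s (hST.trans hs.1)).hasDerivWithinAt) ?_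
      (fun s hs => (hd s hs.1).continuousAt.continuousWithinAt)
      (fun s hs => (hd s hs.1).hasDerivWithinAt) ?_ ⟨ht, le_rfl⟩
    · have : 0 ≤ S ^ p := Real.rpow_nonneg hSpos.le p
      have : 0 ≤ δ / 4 * S ^ p := by positivity
      linarith
    · intro s hs
      have h1 := hle s (hST.trans hs.1)
      have h2 : p * s ^ (p - 1) * e s ≤ p * s ^ (p - 1) * (δ / 4) := by
        have : 0 ≤ s ^ (p - 1) := Real.rpow_nonneg (hSpos.le.trans hs.1) _
        exact mul_le_mul_of_nonneg_left (hS s hs.1).1 (by positivity)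
      linarith
  have hpow : Tendsto (fun t : ℝ => t ^ (-p) * (‖h S‖ - B S)) atTop (nhds 0) := by
    simpa using (tendsto_rpow_neg_atTop hp).mul_const (‖h S‖ - B S)
  have hsum := hpow.add hB0
  rw [add_zero] at hsum
  have hsm : ∀ᶠ t in atTop, t ^ (-p) * (‖h S‖ - B S) + t ^ (-p) * B t < δ / 2 :=
    hsum.eventually_lt_const (by positivity)
  obtain ⟨N, hN⟩ := (hsm.and (eventually_ge_atTop S)).exists_forall_of_atTop
  refine ⟨N, fun t ht => ?_⟩
  have htS := (hN t ht.le).2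
  have h1 := (hN t ht.le).1
  have htpos : 0 < t := hSpos.trans_le htS
  have hk := key t htS
  rw [dist_zero_right, norm_smul, Real.norm_of_nonneg (Real.rpow_nonneg htpos.le _)]
  have hpp : t ^ (-p) * t ^ p = 1 := by
    rw [← Real.rpow_add htpos]; simp
  have hmul := mul_le_mul_of_nonneg_left hk (Real.rpow_nonneg htpos.le (-p))
  have : t ^ (-p) * (‖h S‖ - B S + B t + δ / 4 * t ^ p)
      = t ^ (-p) * (‖h S‖ - B S) + t ^ (-p) * B t + δ / 4 * (t ^ (-p) * t ^ p) := by ring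
  rw [this, hpp] at hmul
  linarith

/-- Existence of a primitive `A` of `t β ε` with `A = o(t²)`. -/
lemma exists_prim {T : ℝ} (hT : 0 < T) {w : ℝ → ℝ} (hw : ∀ t > T, 0 ≤ w t)
    {S : ℝ} (hS : T < S)
    (hc : ContinuousOn w (Set.Ioi T)) (hInt : IntegrableOn (fun t => w t / t) (Set.Ioi T)) :
    ∃ A : ℝ → ℝ, (∀ t ≥ S, HasDerivAt A (t * w t) t) ∧
      Tendsto (fun t => A t / t ^ 2) atTop (nhds 0) := by
  set J : ℝ → ℝ := fun t => ∫ s in S..t, w s / s with hJ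
  have hTpos : ∀ t ≥ S, 0 < t := fun t ht => hT.trans (hS.trans_le ht)
  have hcont1 : ContinuousOn (fun t => w t / t) (Set.Ioi T) :=
    hc.div continuousOn_id (fun t ht => (hT.trans ht).ne')
  have hcont2 : ContinuousOn (fun t => t * w t) (Set.Ioi T) := continuousOn_id.mul hc
  have hder : ∀ (g : ℝ → ℝ), ContinuousOn g (Set.Ioi T) → ∀ t ≥ S,
      HasDerivAt (fun t => ∫ s in S..t, g s) (g t) t := by
    intro g hg t ht
    apply intervalIntegral.integral_hasDerivAt_right
    · apply ContinuousOn.intervalIntegrable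
      apply hg.mono
      rw [Set.uIcc_of_le ht]
      intro s hs
      exact hS.trans_le hs.1
    · exact hg.stronglyMeasurableAtFilter isOpen_Ioi t (hS.trans_le ht)
    · exact hg.continuousAt (Ioi_mem_nhds (hS.trans_le ht))
  have hAd := hder _ hcont2
  have hJd := hder _ hcont1
  refine ⟨fun t => ∫ s in S..t, s * w s, hAd, ?_⟩
  set A : ℝ → ℝ := fun t => ∫ s in S..t, s * w s with hA
  have hJlim : Tendsto J atTop (nhds (∫ s in Set.Ioi S, w s / s)) :=
    intervalIntegral_tendsto_integral_Ioi S (hInt.mono_set (Set.Ioi_subset_Ioi hS.le)) tendsto_id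
  have hAmono : MonotoneOn A (Set.Ici S) := by
    apply monotoneOn_of_deriv_nonneg (convex_Ici S)
    · exact fun t ht => (hAd t ht).continuousAt.continuousWithinAt
    · exact fun t ht => (hAd t (interior_subset ht)).differentiableAt.differentiableWithinAt
    · intro t ht
      rw [(hAd t (interior_subset ht)).deriv]
      have := hTpos t (interior_subset ht)
      exact mul_nonneg this.le (hw t (hS.trans_le (interior_subset ht)))
  have hA0 : A S = 0 := by simp [hA]
  rw [Metric.tendsto_atTop']
  intro δ hδ
  obtain ⟨N, hN⟩ := Metric.tendsto_atTop.1 hJlim (δ / 4) (by positivity)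
  set M := max N S with hM
  have hMS : S ≤ M := le_max_right _ _
  have hlim2 : Tendsto (fun t : ℝ => A M / t ^ 2) atTop (nhds 0) :=
    tendsto_const_nhds.div_atTop (tendsto_pow_atTop two_ne_zero)
  obtain ⟨N2, hN2⟩ := ((hlim2.eventually_lt_const (show (0:ℝ) < δ / 2 by positivity)).and
    (eventually_ge_atTop M)).exists_forall_of_atTop
  refine ⟨N2, fun t ht => ?_⟩
  obtain ⟨h1, h2⟩ := hN2 t ht.le
  have htp := hTpos t (hMS.trans h2)
  have hle : A t - A M ≤ t ^ 2 * (J t - J M) := by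
    have hanti : AntitoneOn (fun s => A s - t ^ 2 * J s) (Set.Icc M t) := by
      have hd : ∀ s ≥ S, HasDerivAt (fun s => A s - t ^ 2 * J s) (s * w s - t ^ 2 * (w s / s)) s :=
        fun s hs => (hAd s hs).sub ((hJd s hs).const_mul _)
      apply antitoneOn_of_deriv_nonpos (convex_Icc M t)
      · exact fun s hs => (hd s (hMS.trans hs.1)).continuousAt.continuousWithinAt
      · exact fun s hs => (hd s (hMS.trans
          (interior_subset hs).1)).differentiableAt.differentiableWithinAt
      · intro s hs
        have hs' := interior_subset hs
        have hsS := hMS.trans hs'.1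
        rw [(hd s hsS).deriv]
        have hsp := hTpos s hsS
        have : s * w s - t ^ 2 * (w s / s) = (s ^ 2 - t ^ 2) * (w s / s) := by field_simp
        rw [this]
        apply mul_nonpos_of_nonpos_of_nonneg
        · nlinarith [hs'.2]
        · exact div_nonneg (hw s (hS.trans_le hsS)) hsp.le
    have := hanti (Set.left_mem_Icc.2 h2) (Set.right_mem_Icc.2 h2) h2
    simp only at this
    linarith
  have hJt := hN t ((le_max_left _ _).trans h2)
  have hJM := hN M (le_max_left _ _)
  rw [Real.dist_eq] at hJt hJM
  have hJJ : J t - J M ≤ δ / 2 := by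
    have := abs_lt.1 hJt
    have := abs_lt.1 hJM
    linarith
  have hAt0 : 0 ≤ A t := by
    rw [← hA0]; exact hAmono (Set.mem_Ici.2 le_rfl) (hMS.trans h2) (hMS.trans h2)
  rw [dist_zero_right, Real.norm_of_nonneg (by positivity)]
  have h3 : A t ≤ A M + t ^ 2 * (δ / 2) := by
    have : t ^ 2 * (J t - J M) ≤ t ^ 2 * (δ / 2) := by gcongr
    linarith
  calc A t / t ^ 2 ≤ (A M + t ^ 2 * (δ / 2)) / t ^ 2 := by gcongr
    _ = A M / t ^ 2 + δ / 2 := by field_simp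
    _ < δ := by linarith

lemma residual_half {X : Type*} [NormedAddCommGroup X] [NormedSpace ℝ X] {θ c C T : ℝ}
    (hθ : 0 < θ) (hc : 0 < c) (hC : 0 ≤ C) (hT : 0 < T)
    {v vd xd P Pd e0 : ℝ → X} {β β' b W W' : ℝ → ℝ}
    (hv : ∀ t ≥ T, HasDerivAt v (vd t) t) (hP : ∀ t ≥ T, HasDerivAt P (Pd t) t)
    (hβ : ∀ t ≥ T, HasDerivAt β (β' t) t) (hβc : ∀ t ≥ T, c ≤ β t)
    (hβ' : ∀ t ≥ T, β' t / β t ≤ (1 - 2 * θ) / (θ * t))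
    (heq : ∀ t ≥ T, P t + (θ * t) • Pd t
      = -((1 / (θ * t * β t)) • vd t) - (b t / (θ * t * β t)) • xd t - e0 t)
    (hvC : ∀ t ≥ T, ‖v t‖ ≤ C * t)
    (hW : ∀ t ≥ T, HasDerivAt W (W' t) t) (hWb : ∀ t ≥ T, b t * θ * t * ‖xd t‖ ^ 2 ≤ W' t)
    (hb : ∀ t ≥ T, 0 ≤ b t)
    (hW0 : Tendsto (fun t => W t / t ^ 2) atTop (nhds 0))
    (hb0 : Tendsto (fun t => b t / t ^ 2) atTop (nhds 0))
    (he0 : Tendsto e0 atTop (nhds 0)) : Tendsto P atTop (nhds 0) := by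
  set p : ℝ := θ⁻¹ with hp
  have hppos : 0 < p := inv_pos.2 hθ
  set q : ℝ → ℝ := fun t => (θ ^ 2 * t ^ 2 * β t)⁻¹ with hq
  set q' : ℝ → ℝ := fun t => -(q t * (2 / t + β' t / β t)) with hq'
  set Q : ℝ := (θ ^ 2 * c)⁻¹ with hQ
  have hQpos : 0 < Q := by positivity
  have hpos : ∀ t ≥ T, 0 < t := fun t ht => hT.trans_le ht
  have hβpos : ∀ t ≥ T, 0 < β t := fun t ht => hc.trans_le (hβc t ht)
  have hqpos : ∀ t ≥ T, 0 < q t := fun t ht => by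
    have := hpos t ht; have := hβpos t ht; simp only [hq]; positivity
  have hqQ : ∀ t ≥ T, q t ≤ Q / t ^ 2 := fun t ht => by
    have h1 := hpos t ht
    have h2 := hβc t ht
    have : Q / t ^ 2 = (θ ^ 2 * t ^ 2 * c)⁻¹ := by simp only [hQ]; field_simp
    rw [this]
    simp only [hq]
    gcongr
  have hqd : ∀ t ≥ T, HasDerivAt q (q' t) t := fun t ht => by
    have h1 := hpos t ht
    have h2 := hβpos t ht
    have h3 := ((((hasDerivAt_id t).pow 2).const_mul (θ ^ 2)).mul (hβ t ht)).inv
      (by simp only [Pi.mul_apply, Pi.pow_apply, id]; positivity)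
    refine h3.congr_deriv ?_
    simp only [Pi.mul_apply, Pi.pow_apply, id, hq', hq]
    push_cast
    field_simp
  have hq'lb : ∀ t ≥ T, -(p * q t / t) ≤ q' t := fun t ht => by
    have h1 := hpos t ht
    have h2 : (2 / t + β' t / β t) ≤ p / t := by
      have h3 := hβ' t ht
      have : (1 - 2 * θ) / (θ * t) = p / t - 2 / t := by simp only [hp]; field_simp
      linarith
    have := mul_le_mul_of_nonneg_left h2 (hqpos t ht).le
    simp only [hq']
    have h4 : p * q t / t = q t * (p / t) := by ring
    linarith
  have hrp : ∀ t ≥ T, t ^ p = t ^ (p - 1) * t := fun t ht => by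
    have h1 := hpos t ht
    rw [Real.rpow_sub_one h1.ne']; field_simp
  have hrd : ∀ t ≥ T, HasDerivAt (fun t : ℝ => t ^ p) (p * t ^ (p - 1)) t := fun t ht =>
    Real.hasDerivAt_rpow_const (Or.inl (hpos t ht).ne')
  -- the weighted quantity
  have hh : ∀ t ≥ T, HasDerivAt (fun t => t ^ p • (P t + q t • v t))
      ((p * t ^ (p - 1)) • (q t • v t - e0 t) - (t ^ p * q t * b t) • xd t
        + (t ^ p * q' t) • v t) t := fun t ht => by
    have h1 := hpos t ht
    have h2 := hβpos t ht
    have h3 := (hrd t ht).smul ((hP t ht).add ((hqd t ht).smul (hv t ht)))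
    refine h3.congr_deriv ?_
    have h4 : P t = -((1 / (θ * t * β t)) • vd t) - (b t / (θ * t * β t)) • xd t - e0 t
        - (θ * t) • Pd t := by rw [← heq t ht]; abel
    simp only [Pi.add_apply]
    show t ^ p • (Pd t + (q t • vd t + q' t • v t)) + (p * t ^ (p - 1)) • (P t + q t • v t) = _
    rw [h4, hrp t ht]
    have e1 : p * t ^ (p - 1) * (1 / (θ * t * β t)) = t ^ (p - 1) * t * q t := by
      simp only [hp, hq]; field_simp
    have e2 : p * t ^ (p - 1) * (b t / (θ * t * β t)) = t ^ (p - 1) * t * q t * b t := by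
      simp only [hp, hq]; field_simp
    have e3 : p * t ^ (p - 1) * (θ * t) = t ^ (p - 1) * t := by
      simp only [hp]; field_simp
    simp only [smul_add, smul_sub, smul_neg, smul_smul, e1, e2, e3]
    abel
  set F : ℝ → ℝ := fun t => C * (q t * t) + Q / (2 * θ) * (W t / t ^ 2) with hF
  have hFd : ∀ t ≥ T, HasDerivAt F (C * (q' t * t + q t * 1)
      + Q / (2 * θ) * ((W' t * t ^ 2 - W t * (2 * t)) / (t ^ 2) ^ 2)) t := fun t ht => by
    have h1 := hpos t ht
    have h2 : HasDerivAt (fun t : ℝ => t ^ 2) (2 * t) t := by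
      simpa using hasDerivAt_pow 2 t
    exact (((hqd t ht).mul (hasDerivAt_id' t)).const_mul C).add
      (((hW t ht).div h2 (by positivity)).const_mul _)
  have hBd : ∀ t ≥ T, HasDerivAt (fun t => t ^ p * F t) _ t := fun t ht =>
    (hrd t ht).mul (hFd t ht)
  have hinv : Tendsto (fun t : ℝ => Q * C / t) atTop (nhds 0) :=
    tendsto_const_nhds.div_atTop tendsto_id
  have hinv2 : Tendsto (fun t : ℝ => Q / t) atTop (nhds 0) :=
    tendsto_const_nhds.div_atTop tendsto_id
  have hqt : ∀ t ≥ T, q t * t ≤ Q / t := fun t ht => by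
    have h1 := hpos t ht
    calc q t * t ≤ Q / t ^ 2 * t := by gcongr; exact hqQ t ht
      _ = Q / t := by field_simp
  have hqv : ∀ t ≥ T, q t * ‖v t‖ ≤ Q * C / t := fun t ht => by
    have h1 := hpos t ht
    have h0 := (hqpos t ht).le
    calc q t * ‖v t‖ ≤ q t * (C * t) := by gcongr; exact hvC t ht
      _ = C * (q t * t) := by ring
      _ ≤ C * (Q / t) := by gcongr; exact hqt t ht
      _ = _ := by ring
  have hqt0 : Tendsto (fun t => q t * t) atTop (nhds 0) := by
    refine squeeze_zero' ?_ ?_ hinv2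
    · filter_upwards [eventually_ge_atTop T] with t ht
      exact mul_nonneg (hqpos t ht).le (hpos t ht).le
    · filter_upwards [eventually_ge_atTop T] with t ht using hqt t ht
  have hqv0 : Tendsto (fun t => q t • v t) atTop (nhds 0) := by
    rw [tendsto_zero_iff_norm_tendsto_zero]
    refine squeeze_zero' (Eventually.of_forall fun t => norm_nonneg _) ?_ hinv
    filter_upwards [eventually_ge_atTop T] with t ht
    rw [norm_smul, Real.norm_of_nonneg (hqpos t ht).le]
    exact hqv t ht
  have hF0 : Tendsto F atTop (nhds 0) := by
    simpa [hF] using (hqt0.const_mul C).add (hW0.const_mul (Q / (2 * θ)))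
  set e1 : ℝ → ℝ := fun t => 2 * (Q * C / t) + ‖e0 t‖ + θ * Q / 2 * (b t / t ^ 2)
    - F t + Q * (W t / t ^ 2) + C * (q t * t) with he1
  have he1lim : Tendsto e1 atTop (nhds 0) := by
    have := (((((hinv.const_mul 2).add he0.norm).add (hb0.const_mul (θ * Q / 2))).sub hF0).add
      (hW0.const_mul Q)).add (hqt0.const_mul C)
    simpa [he1] using this
  have hfin := fin_decay hppos hT hh hBd (e := e1) ?_ he1lim ?_
  · have h1 : Tendsto (fun t => P t + q t • v t) atTop (nhds 0) := by
      refine hfin.congr' ?_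
      filter_upwards [eventually_ge_atTop T] with t ht
      rw [smul_smul, ← Real.rpow_add (hpos t ht)]; simp
    simpa using h1.sub hqv0
  · intro t ht
    have h1 := hpos t ht
    have h2 := hβpos t ht
    have hr : 0 < t ^ (p - 1) := Real.rpow_pos_of_pos h1 _
    rw [hrp t ht]
    set r := t ^ (p - 1) with hrdef
    have hq0 := hqpos t ht
    have hb0 := hb t ht
    have n1 : ‖(p * r) • (q t • v t - e0 t)‖ ≤ p * r * (Q * C / t + ‖e0 t‖) := by
      rw [norm_smul, Real.norm_of_nonneg (by positivity)]
      gcongr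
      refine (norm_sub_le _ _).trans ?_
      rw [norm_smul, Real.norm_of_nonneg hq0.le]
      gcongr
      exact hqv t ht
    have n2 : ‖(r * t * q t * b t) • xd t‖
        ≤ p * r * (θ * Q / 2 * (b t / t ^ 2)) + r * t * (Q / (2 * θ) * (W' t / t ^ 2)) := by
      rw [norm_smul, Real.norm_of_nonneg (by positivity)]
      have y1 : t * ‖xd t‖ ≤ 1 / 2 * (1 + t ^ 2 * ‖xd t‖ ^ 2) := by
        nlinarith [sq_nonneg (t * ‖xd t‖ - 1)]
      calc r * t * q t * b t * ‖xd t‖ = r * (q t) * b t * (t * ‖xd t‖) := by ring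
        _ ≤ r * (Q / t ^ 2) * b t * (1 / 2 * (1 + t ^ 2 * ‖xd t‖ ^ 2)) := by
            gcongr
            exact hqQ t ht
        _ = p * r * (θ * Q / 2 * (b t / t ^ 2))
            + r * t * (Q / (2 * θ) * ((b t * θ * t * ‖xd t‖ ^ 2) / t ^ 2)) := by
            simp only [hp]; field_simp
        _ ≤ _ := by
            gcongr
            exact hWb t ht
    have n3 : ‖(r * t * q' t) • v t‖ ≤ p * r * (Q * C / t)
        + r * t * (C * (q' t * t + q t * 1)) + p * r * (C * (q t * t)) := by
      have hab : |q' t| ≤ q' t + 2 * (p * q t / t) := by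
        have := hq'lb t ht
        have h5 : 0 ≤ p * q t / t := by positivity
        rw [abs_le]; constructor <;> linarith
      have h6 : 0 ≤ q' t + p * q t / t := by linarith [hq'lb t ht]
      rw [norm_smul, Real.norm_eq_abs, abs_mul, abs_of_pos (by positivity : 0 < r * t)]
      calc r * t * |q' t| * ‖v t‖ ≤ r * t * (q' t + 2 * (p * q t / t)) * ‖v t‖ := by gcongr
        _ = r * t * (q' t + p * q t / t) * ‖v t‖ + p * r * (q t * ‖v t‖) := by field_simp; ring
        _ ≤ r * t * (q' t + p * q t / t) * (C * t) + p * r * (Q * C / t) := by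
          gcongr
          · exact hvC t ht
          · exact hqv t ht
        _ = p * r * (Q * C / t) + r * t * (C * (q' t * t)) + p * r * (C * (q t * t)) := by
          field_simp; ring
        _ ≤ _ := by
          have : 0 ≤ r * t * (C * (q t * 1)) := by positivity
          nlinarith
    have n4 : ‖(p * r) • (q t • v t - e0 t) - (r * t * q t * b t) • xd t
        + (r * t * q' t) • v t‖ ≤ ‖(p * r) • (q t • v t - e0 t)‖ + ‖(r * t * q t * b t) • xd t‖
        + ‖(r * t * q' t) • v t‖ :=
      (norm_add_le _ _).trans (by gcongr; exact norm_sub_le _ _)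
    refine n4.trans ((add_le_add (add_le_add n1 n2) n3).trans (le_of_eq ?_))
    have hWid : r * t * (Q / (2 * θ) * ((W' t * t ^ 2 - W t * (2 * t)) / (t ^ 2) ^ 2))
       = r * t * (Q / (2 * θ) * (W' t / t ^ 2)) - p * r * (Q * (W t / t ^ 2)) := by
      simp only [hp]; field_simp
    simp only [he1]
    rw [mul_add (r * t) (C * _), hWid]
    ring
  · refine hF0.congr' ?_
    filter_upwards [eventually_ge_atTop T] with t ht
    rw [← mul_assoc, ← Real.rpow_add (hpos t ht)]; simp

section aux2
variable {X Y : Type*} [NormedAddCommGroup X] [InnerProductSpace ℝ X] [CompleteSpace X]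

lemma grad_of_subgrad {f : X → ℝ} (hf : Differentiable ℝ f) {xs c : X}
    (h : ∀ x, f xs + ⟪c, x - xs⟫ ≤ f x) : gradient f xs = c := by
  set w := gradient f xs - c with hw
  have hl : HasDerivAt (fun s : ℝ => xs + s • w) w 0 := by
    simpa using ((hasDerivAt_id (0:ℝ)).smul_const w).const_add xs
  have h1 := comp_grad hf hl
  have h2 := h1.sub ((hasDerivAt_id' (0:ℝ)).mul_const ⟪c, w⟫)
  have hmin : IsLocalMin ((fun s : ℝ => f (xs + s • w)) - fun s : ℝ => s * ⟪c, w⟫) 0 := by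
    refine Eventually.of_forall fun s => ?_
    have := h (xs + s • w)
    simp only [add_sub_cancel_left, inner_smul_right] at this
    simp only [Pi.sub_apply, zero_smul, add_zero, zero_mul, sub_zero]
    linarith
  have h3 := hmin.hasDerivAt_eq_zero h2
  simp only [zero_smul, add_zero, one_mul] at h3
  rw [← inner_sub_left, ← hw, inner_self_eq_zero] at h3
  exact sub_eq_zero.1 h3

lemma deriv_facts {X : Type*} [NormedAddCommGroup X] [NormedSpace ℝ X] {x : ℝ → X} {t₀ : ℝ}
    (hx : ContDiffOn ℝ 2 x (Set.Ici t₀)) {t : ℝ} (ht : t₀ < t) :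
    HasDerivAt x (deriv x t) t ∧ HasDerivAt (deriv x) (deriv (deriv x) t) t := by
  have h1 : ContDiffOn ℝ 2 x (Set.Ioi t₀) := hx.mono Set.Ioi_subset_Ici_self
  have h2 : ContDiffOn ℝ 1 (deriv x) (Set.Ioi t₀) :=
    h1.deriv_of_isOpen isOpen_Ioi (by norm_num)
  have hm : Set.Ioi t₀ ∈ nhds t := Ioi_mem_nhds ht
  exact ⟨((h1.contDiffAt hm).differentiableAt (by norm_num)).hasDerivAt,
    ((h2.contDiffAt hm).differentiableAt (by norm_num)).hasDerivAt⟩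

lemma deriv_fact1 {x : ℝ → ℝ} {t₀ : ℝ}
    (hx : ContDiffOn ℝ 1 x (Set.Ici t₀)) {t : ℝ} (ht : t₀ < t) :
    HasDerivAt x (deriv x t) t :=
  ((hx.contDiffAt (Ici_mem_nhds ht)).differentiableAt (by norm_num)).hasDerivAt

lemma half_res {f : X → ℝ} {θ c T : ℝ} (hθ : 0 < θ) (hc : 0 < c) (hT : 0 < T)
    {x xd xdd P Pd : ℝ → X} {xs : X} {α β ε β' W W' : ℝ → ℝ}
    (hx : ∀ t ≥ T, HasDerivAt x (xd t) t) (hxd : ∀ t ≥ T, HasDerivAt xd (xdd t) t)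
    (hP : ∀ t ≥ T, HasDerivAt P (Pd t) t)
    (hβ : ∀ t ≥ T, HasDerivAt β (β' t) t) (hβc : ∀ t ≥ T, c ≤ β t)
    (hβ' : ∀ t ≥ T, β' t / β t ≤ (1 - 2 * θ) / (θ * t))
    (heq : ∀ t ≥ T, xdd t + α t • xd t + β t • (gradient f (x t) - gradient f xs + ε t • x t
      + (P t + (θ * t) • Pd t)) = 0)
    (hvC : ∀ t ≥ T, ‖x t - xs + (θ * t) • xd t‖ ≤ 1 * t)
    (hW : ∀ t ≥ T, HasDerivAt W (W' t) t)
    (hWb : ∀ t ≥ T, (θ * (t * α t) - θ - 1) * θ * t * ‖xd t‖ ^ 2 ≤ W' t)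
    (hb : ∀ t ≥ T, 0 ≤ θ * (t * α t) - θ - 1)
    (hW0 : Tendsto (fun t => W t / t ^ 2) atTop (nhds 0))
    (hb0 : Tendsto (fun t => (θ * (t * α t) - θ - 1) / t ^ 2) atTop (nhds 0))
    (he0 : Tendsto (fun t => gradient f (x t) - gradient f xs + ε t • x t) atTop (nhds 0)) :
    Tendsto P atTop (nhds 0) := by
  refine residual_half hθ hc zero_le_one hT
    (v := fun t => x t - xs + (θ * t) • xd t)
    (vd := fun t => xd t + ((θ * t) • xdd t + (θ * 1) • xd t))
    (b := fun t => θ * (t * α t) - θ - 1) (xd := xd)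
    (e0 := fun t => gradient f (x t) - gradient f xs + ε t • x t) ?_ hP hβ hβc hβ' ?_ hvC hW hWb hb
    hW0 hb0 he0
  · intro t ht
    exact ((hx t ht).sub_const xs).add (((hasDerivAt_id' t).const_mul θ).smul (hxd t ht))
  · intro t ht
    have h1 : 0 < t := hT.trans_le ht
    have h2 : 0 < β t := hc.trans_le (hβc t ht)
    have h3 := heq t ht
    generalize P t + (θ * t) • Pd t = k at *
    generalize gradient f (x t) - gradient f xs + ε t • x t = e at *
    have h4 : xdd t = -(α t • xd t) - β t • (e + k) := by
      rw [← sub_eq_zero, ← h3]; abel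
    simp only [h4]
    match_scalars <;> field_simp <;> ring

end aux2

lemma exists_beta_lb {β : ℝ → ℝ} {t₀ : ℝ} (hβpos : ∀ t ≥ t₀, 0 < β t)
    (h : atTop.liminf β ≠ 0) : ∃ c > 0, ∀ᶠ t in atTop, c ≤ β t := by
  by_contra hcon
  push Not at hcon
  apply h
  rw [liminf_eq]
  apply IsGreatest.csSup_eq
  constructor
  · filter_upwards [eventually_ge_atTop t₀] with t ht using (hβpos t ht).le
  · intro a ha
    by_contra hlt
    exact hcon a (not_le.1 hlt) (Eventually.mono ha fun _ h1 => not_lt.2 h1)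

lemma liminf_zero {u : ℝ → ℝ} (h0 : ∀ t, 0 ≤ u t) (h : ∀ δ > 0, ∃ᶠ t in atTop, u t < δ) :
    atTop.liminf u = 0 := by
  rw [liminf_eq]
  apply IsGreatest.csSup_eq
  constructor
  · exact Eventually.of_forall h0
  · intro a ha
    by_contra hlt
    obtain ⟨t, h1, h2⟩ := ((h a (not_le.1 hlt)).and_eventually ha).exists
    linarith

section compactness
variable {n m : ℕ}

lemma saddle_grads {f : EuclideanSpace ℝ (Fin n) → ℝ} {g : EuclideanSpace ℝ (Fin m) → ℝ}
    (hf : Differentiable ℝ f) (hg : Differentiable ℝ g)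
    {K : EuclideanSpace ℝ (Fin n) →L[ℝ] EuclideanSpace ℝ (Fin m)}
    {xh : EuclideanSpace ℝ (Fin n)} {yh : EuclideanSpace ℝ (Fin m)} (h : IsSaddle f g K xh yh) :
    gradient f xh = -(ContinuousLinearMap.adjoint K yh) ∧ gradient g yh = K xh := by
  constructor
  · apply grad_of_subgrad hf
    intro x
    have := (h x yh).2
    simp only [Lag] at this
    rw [inner_neg_left, ContinuousLinearMap.adjoint_inner_left, map_sub, inner_sub_right,
      real_inner_comm, real_inner_comm (K xh)]
    linarith
  · apply grad_of_subgrad hg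
    intro y
    have := (h xh y).1
    simp only [Lag] at this
    rw [inner_sub_right]
    linarith

lemma saddle_of_res {f : EuclideanSpace ℝ (Fin n) → ℝ} {g : EuclideanSpace ℝ (Fin m) → ℝ}
    (hf : Differentiable ℝ f) (hg : Differentiable ℝ g)
    (hfconv : ConvexOn ℝ Set.univ f) (hgconv : ConvexOn ℝ Set.univ g)
    {K : EuclideanSpace ℝ (Fin n) →L[ℝ] EuclideanSpace ℝ (Fin m)}
    {xh x : EuclideanSpace ℝ (Fin n)} {yh y : EuclideanSpace ℝ (Fin m)} (h : IsSaddle f g K xh yh)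
    (h1 : f x - f xh - ⟪gradient f xh, x - xh⟫ ≤ 0)
    (h2 : g y - g yh - ⟪gradient g yh, y - yh⟫ ≤ 0)
    (h3 : K (x - xh) = 0) (h4 : ContinuousLinearMap.adjoint K (y - yh) = 0) :
    IsSaddle f g K x y := by
  obtain ⟨g1, g2⟩ := saddle_grads hf hg h
  intro x' y'
  have c1 := convex_grad_s17 hf hfconv xh x'
  have c2 := convex_grad_s17 hg hgconv yh y'
  rw [map_sub, sub_eq_zero] at h3 h4
  rw [g1] at h1 c1
  rw [g2] at h2 c2
  rw [← h3, inner_sub_right] at h2 c2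
  rw [← h4, inner_neg_left, inner_sub_right, ContinuousLinearMap.adjoint_inner_left,
    ContinuousLinearMap.adjoint_inner_left] at h1 c1
  simp only [Lag]
  rw [real_inner_comm y (K x')]
  constructor
  · linarith
  · rw [real_inner_comm y (K x)]; linarith

lemma compact_lemma {f : EuclideanSpace ℝ (Fin n) → ℝ} {g : EuclideanSpace ℝ (Fin m) → ℝ}
    (hf : Differentiable ℝ f) (hg : Differentiable ℝ g)
    (hfconv : ConvexOn ℝ Set.univ f) (hgconv : ConvexOn ℝ Set.univ g)
    {K : EuclideanSpace ℝ (Fin n) →L[ℝ] EuclideanSpace ℝ (Fin m)}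
    {xh : EuclideanSpace ℝ (Fin n)} {yh : EuclideanSpace ℝ (Fin m)}
    (hmin : IsSaddle f g K xh yh ∧
      ∀ xs ys, IsSaddle f g K xs ys → ‖xh‖ ^ 2 + ‖yh‖ ^ 2 ≤ ‖xs‖ ^ 2 + ‖ys‖ ^ 2)
    {δ : ℝ} (hδ : 0 < δ) : ∃ η > 0, ∀ x y,
      f x - f xh - ⟪gradient f xh, x - xh⟫ < η → g y - g yh - ⟪gradient g yh, y - yh⟫ < η →
      ‖K (x - xh)‖ < η → ‖ContinuousLinearMap.adjoint K (y - yh)‖ < η →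
      ‖x‖ ^ 2 + ‖y‖ ^ 2 < ‖xh‖ ^ 2 + ‖yh‖ ^ 2 + η →
      Real.sqrt (‖x - xh‖ ^ 2 + ‖y - yh‖ ^ 2) < δ := by
  let Ψ : EuclideanSpace ℝ (Fin n) × EuclideanSpace ℝ (Fin m) → ℝ := fun z =>
    max (max (max (f z.1 - f xh - ⟪gradient f xh, z.1 - xh⟫)
      (g z.2 - g yh - ⟪gradient g yh, z.2 - yh⟫))
      (max ‖K (z.1 - xh)‖ ‖ContinuousLinearMap.adjoint K (z.2 - yh)‖))
      (‖z.1‖ ^ 2 + ‖z.2‖ ^ 2 - (‖xh‖ ^ 2 + ‖yh‖ ^ 2))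
  have hfc := hf.continuous
  have hgc := hg.continuous
  have hΨ : Continuous Ψ := by
    simp only [Ψ]; fun_prop
  let d : EuclideanSpace ℝ (Fin n) × EuclideanSpace ℝ (Fin m) → ℝ := fun z =>
    Real.sqrt (‖z.1 - xh‖ ^ 2 + ‖z.2 - yh‖ ^ 2)
  have hd : Continuous d := by simp only [d]; fun_prop
  set M := ‖xh‖ ^ 2 + ‖yh‖ ^ 2 + 1 with hM
  have hM1 : 1 ≤ M := by have := sq_nonneg ‖xh‖; have := sq_nonneg ‖yh‖; linarith
  let S := Metric.closedBall (0 : EuclideanSpace ℝ (Fin n) × EuclideanSpace ℝ (Fin m)) M ∩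
    {z | δ ≤ d z}
  have hS : IsCompact S :=
    (isCompact_closedBall _ _).inter_right (isClosed_le continuous_const hd)
  have hpos : ∀ z, Ψ z ≤ 0 → d z = 0 := by
    rintro ⟨x, y⟩ hz
    simp only [Ψ, max_le_iff] at hz
    obtain ⟨⟨⟨a1, a2⟩, a3, a4⟩, a5⟩ := hz
    have b3 : K (x - xh) = 0 := norm_le_zero_iff.1 a3
    have b4 : ContinuousLinearMap.adjoint K (y - yh) = 0 := norm_le_zero_iff.1 a4
    set xm := (1 / 2 : ℝ) • xh + (1 / 2 : ℝ) • x with hxm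
    set ym := (1 / 2 : ℝ) • yh + (1 / 2 : ℝ) • y with hym
    have hxm' : xm - xh = (1 / 2 : ℝ) • (x - xh) := by rw [hxm]; module
    have hym' : ym - yh = (1 / 2 : ℝ) • (y - yh) := by rw [hym]; module
    have hfm : f xm ≤ 1 / 2 * f xh + 1 / 2 * f x := by
      exact hfconv.2 (Set.mem_univ xh) (Set.mem_univ x) (by norm_num : (0:ℝ) ≤ 1 / 2)
        (by norm_num : (0:ℝ) ≤ 1 / 2) (by norm_num)
    have hgm : g ym ≤ 1 / 2 * g yh + 1 / 2 * g y := by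
      exact hgconv.2 (Set.mem_univ yh) (Set.mem_univ y) (by norm_num : (0:ℝ) ≤ 1 / 2)
        (by norm_num : (0:ℝ) ≤ 1 / 2) (by norm_num)
    have hsad : IsSaddle f g K xm ym := by
      apply saddle_of_res hf hg hfconv hgconv hmin.1
      · rw [hxm', inner_smul_right]; linarith
      · rw [hym', inner_smul_right]; linarith
      · rw [hxm', map_smul, b3, smul_zero]
      · rw [hym', map_smul, b4, smul_zero]
    have hle := hmin.2 xm ym hsad
    have px := parallelogram_law_with_norm ℝ xh x
    have py := parallelogram_law_with_norm ℝ yh y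
    have nx : ‖xm‖ ^ 2 = 1 / 4 * ‖xh + x‖ ^ 2 := by
      rw [hxm, ← smul_add, norm_smul, mul_pow]; norm_num
    have ny : ‖ym‖ ^ 2 = 1 / 4 * ‖yh + y‖ ^ 2 := by
      rw [hym, ← smul_add, norm_smul, mul_pow]; norm_num
    simp only [d]
    rw [norm_sub_rev x, norm_sub_rev y]
    apply Real.sqrt_eq_zero_of_nonpos
    nlinarith
  have hbound : ∀ x y, ‖x‖ ^ 2 + ‖y‖ ^ 2 < ‖xh‖ ^ 2 + ‖yh‖ ^ 2 + 1 → ((x, y) :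
      EuclideanSpace ℝ (Fin n) × EuclideanSpace ℝ (Fin m)) ∈
      Metric.closedBall (0 : EuclideanSpace ℝ (Fin n) × EuclideanSpace ℝ (Fin m)) M := by
    intro x y hxy
    rw [mem_closedBall_zero_iff, Prod.norm_def, max_le_iff]
    have := sq_nonneg ‖x‖
    have := sq_nonneg ‖y‖
    constructor
    · show ‖x‖ ≤ M
      nlinarith
    · show ‖y‖ ≤ M
      nlinarith
  by_cases hne : S.Nonempty
  · obtain ⟨z0, hz0, hz0min⟩ := hS.exists_isMinOn hne hΨ.continuousOn
    have hz0pos : 0 < Ψ z0 := by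
      by_contra hcon
      have h1 := hpos z0 (not_lt.1 hcon)
      have h2 : δ ≤ d z0 := hz0.2
      linarith
    refine ⟨min 1 (Ψ z0), by positivity, fun x y a1 a2 a3 a4 a5 => ?_⟩
    by_contra hcon
    have hmem : (x, y) ∈ S :=
      ⟨hbound x y (a5.trans_le (by gcongr; exact min_le_left _ _)), not_lt.1 hcon⟩
    have h1 : Ψ z0 ≤ Ψ (x, y) := hz0min hmem
    have h2 : Ψ (x, y) < min 1 (Ψ z0) := by
      simp only [Ψ, max_lt_iff]
      simp only [Ψ] at a1 a2 a3 a4 a5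
      exact ⟨⟨⟨a1, a2⟩, a3, a4⟩, by linarith⟩
    exact absurd (h1.trans_lt (h2.trans_le (min_le_right _ _))) (lt_irrefl _)
  · refine ⟨1, one_pos, fun x y a1 a2 a3 a4 a5 => ?_⟩
    by_contra hcon
    exact hne ⟨(x, y), hbound x y a5, not_lt.1 hcon⟩

end compactness

set_option maxHeartbeats 4000000 in
/-- Theorem 3.3, strong convergence: under the slow-decay condition
`∫ β(t)ε(t)/t dt < ∞`, `liminf β ≠ 0`, and `t²β(t)ε(t) → ∞`, the trajectory satisfies
`liminf ‖(x(t), y(t)) − (x̂*, ŷ*)‖ = 0` where `(x̂*, ŷ*)` is the minimum-norm saddle point;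
and if the trajectory eventually stays inside the open ball `B(0, ‖(x̂*, ŷ*)‖)` or
eventually stays in its complement, then `‖(x(t), y(t)) − (x̂*, ŷ*)‖ → 0`. -/
theorem stmt_17 {n m : ℕ} (t₀ θ L₁ L₂ : ℝ) (ht₀ : 0 < t₀) (hθ : 0 < θ)
    (hL₁ : 0 < L₁) (hL₂ : 0 < L₂)
    (f : EuclideanSpace ℝ (Fin n) → ℝ) (g : EuclideanSpace ℝ (Fin m) → ℝ)
    (hf : Differentiable ℝ f) (hg : Differentiable ℝ g)
    (hfconv : ConvexOn ℝ Set.univ f) (hgconv : ConvexOn ℝ Set.univ g)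
    (K : EuclideanSpace ℝ (Fin n) →L[ℝ] EuclideanSpace ℝ (Fin m))
    (α β ε : ℝ → ℝ)
    (hαC1 : ContDiffOn ℝ 1 α (Set.Ici t₀)) (hβC1 : ContDiffOn ℝ 1 β (Set.Ici t₀))
    (hεC1 : ContDiffOn ℝ 1 ε (Set.Ici t₀))
    (hαpos : ∀ t ≥ t₀, 0 < α t) (hβpos : ∀ t ≥ t₀, 0 < β t) (hεpos : ∀ t ≥ t₀, 0 < ε t)
    (hα : ∀ t ≥ t₀, (1 + θ) / (θ * t) ≤ α t)
    (hfLip : ∀ u v, ‖gradient f u - gradient f v‖ ≤ L₁ * ‖u - v‖)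
    (hgLip : ∀ u v, ‖gradient g u - gradient g v‖ ≤ L₂ * ‖u - v‖)
    (hβ' : ∀ t ≥ t₀, deriv β t / β t ≤ (1 - 2 * θ) / (θ * t))
    (hαε : ∀ t ≥ t₀, α t + t * deriv α t ≤ t * β t * ε t)
    (hεanti : AntitoneOn ε (Set.Ici t₀))
    (hεint : IntegrableOn (fun t => β t * ε t / t) (Set.Ioi t₀))
    (hβliminf : atTop.liminf β ≠ 0)
    (hβεtop : Tendsto (fun t => t ^ 2 * β t * ε t) atTop atTop)
    (x : ℝ → EuclideanSpace ℝ (Fin n)) (y : ℝ → EuclideanSpace ℝ (Fin m))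
    (hsol : IsSol t₀ θ f g K α β ε x y)
    (xh : EuclideanSpace ℝ (Fin n)) (yh : EuclideanSpace ℝ (Fin m))
    (hmin : IsSaddle f g K xh yh ∧
      ∀ xs ys, IsSaddle f g K xs ys → ‖xh‖ ^ 2 + ‖yh‖ ^ 2 ≤ ‖xs‖ ^ 2 + ‖ys‖ ^ 2) :
    atTop.liminf (fun t => Real.sqrt (‖x t - xh‖ ^ 2 + ‖y t - yh‖ ^ 2)) = 0 ∧
    ((∃ T ≥ t₀,
        (∀ t ≥ T, ‖x t‖ ^ 2 + ‖y t‖ ^ 2 < ‖xh‖ ^ 2 + ‖yh‖ ^ 2) ∨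
        (∀ t ≥ T, ¬ (‖x t‖ ^ 2 + ‖y t‖ ^ 2 < ‖xh‖ ^ 2 + ‖yh‖ ^ 2))) →
      Tendsto (fun t => Real.sqrt (‖x t - xh‖ ^ 2 + ‖y t - yh‖ ^ 2)) atTop (nhds 0)) := by
  obtain ⟨hxC, hyC, hode⟩ := hsol
  obtain ⟨c, hc, hβc0⟩ := exists_beta_lb hβpos hβliminf
  obtain ⟨T, hTall⟩ := (hβc0.and (eventually_ge_atTop (t₀ + 1))).exists_forall_of_atTop
  have hTt0 : t₀ < T := by have := (hTall T le_rfl).2; linarith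
  have hT : 0 < T := ht₀.trans hTt0
  have hβc : ∀ t ≥ T, c ≤ β t := fun t ht => (hTall t ht).1
  have hgt : ∀ t ≥ T, t₀ < t := fun t ht => hTt0.trans_le ht
  have hge : ∀ t ≥ T, t ≥ t₀ := fun t ht => (hgt t ht).le
  have htpos : ∀ t ≥ T, 0 < t := fun t ht => hT.trans_le ht
  obtain ⟨g1, g2⟩ := saddle_grads hf hg hmin.1
  have hx := fun t (ht : t ≥ T) => (deriv_facts hxC (hgt t ht)).1
  have hxd := fun t (ht : t ≥ T) => (deriv_facts hxC (hgt t ht)).2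
  have hy := fun t (ht : t ≥ T) => (deriv_facts hyC (hgt t ht)).1
  have hyd := fun t (ht : t ≥ T) => (deriv_facts hyC (hgt t ht)).2
  have hαd := fun t (ht : t ≥ T) => deriv_fact1 hαC1 (hgt t ht)
  have hβd := fun t (ht : t ≥ T) => deriv_fact1 hβC1 (hgt t ht)
  have hεd := fun t (ht : t ≥ T) => deriv_fact1 hεC1 (hgt t ht)
  have hε'np : ∀ t ≥ T, deriv ε t ≤ 0 := fun t ht => by
    have h1 := hεanti.derivWithin_nonpos (x := t)
    rwa [derivWithin_of_mem_nhds (Ici_mem_nhds (hgt t ht))] at h1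
  -- the two halves of the system, centred at the saddle point
  have heqx : ∀ t ≥ T, deriv (deriv x) t + α t • deriv x t + β t • (gradient f (x t)
      - gradient f xh + ε t • x t + (ContinuousLinearMap.adjoint K (y t - yh)
        + (θ * t) • ContinuousLinearMap.adjoint K (deriv y t))) = 0 := fun t ht => by
    have h1 := (hode t (hge t ht)).1
    rw [← h1, g1, map_add, map_sub, map_smul]
    congr 2
    abel
  have heqy : ∀ t ≥ T, deriv (deriv y) t + α t • deriv y t + β t • (gradient g (y t)
      - gradient g yh + ε t • y t + (-(K (x t - xh))
        + (θ * t) • (-(K (deriv x t))))) = 0 := fun t ht => by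
    have h1 := (hode t (hge t ht)).2
    rw [← h1, g2, map_add, map_sub, map_smul, sub_eq_add_neg _ (β t • _), ← smul_neg]
    congr 2
    rw [smul_neg]
    abel
  set Dx : ℝ → ℝ := fun t => f (x t) - f xh - ⟪gradient f xh, x t - xh⟫ with hDx
  set Dy : ℝ → ℝ := fun t => g (y t) - g yh - ⟪gradient g yh, y t - yh⟫ with hDy
  have hDx0 : ∀ t, 0 ≤ Dx t := fun t => by
    have := convex_grad_s17 hf hfconv xh (x t); simp only [hDx]; linarith
  have hDy0 : ∀ t, 0 ≤ Dy t := fun t => by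
    have := convex_grad_s17 hg hgconv yh (y t); simp only [hDy]; linarith
  set N : ℝ → ℝ := fun t => ‖x t‖ ^ 2 + ‖y t‖ ^ 2 with hN
  have hN0 : ∀ t, 0 ≤ N t := fun t => by simp only [hN]; positivity
  set Ns : ℝ := ‖xh‖ ^ 2 + ‖yh‖ ^ 2 with hNs
  have hNs0 : 0 ≤ Ns := by positivity
  set b : ℝ → ℝ := fun t => θ * (t * α t) - θ - 1 with hb
  have hb0 : ∀ t ≥ T, 0 ≤ b t := fun t ht => by
    have h1 := hα t (hge t ht)
    have h2 := htpos t ht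
    rw [div_le_iff₀ (by positivity)] at h1
    simp only [hb]; linarith
  set vx : ℝ → EuclideanSpace ℝ (Fin n) := fun t => x t - xh + (θ * t) • deriv x t with hvx
  set vy : ℝ → EuclideanSpace ℝ (Fin m) := fun t => y t - yh + (θ * t) • deriv y t with hvy
  set E : ℝ → ℝ := fun t => halfE θ f xh α β ε x (deriv x) t + halfE θ g yh α β ε y (deriv y) t
    with hE
  set R' : ℝ → ℝ := fun t => θ ^ 2 * (2 * t * β t + t ^ 2 * deriv β t) with hR'
  have hR'le : ∀ t ≥ T, R' t ≤ θ * t * β t := fun t ht => by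
    have h1 := hβ' t (hge t ht)
    have h2 := htpos t ht
    have h3 := hβpos t (hge t ht)
    rw [div_le_div_iff₀ h3 (by positivity)] at h1
    simp only [hR']
    have h4 := mul_le_mul_of_nonneg_left h1 (by positivity : 0 ≤ θ * t)
    nlinarith
  have hEd : ∀ t ≥ T, ∃ e', HasDerivAt E e' t ∧ e' ≤ R' t * (Dx t + Dy t + ε t / 2 * N t)
      + θ ^ 2 * t ^ 2 * β t * (deriv ε t / 2 * N t)
      - θ * t * β t * (Dx t + Dy t + ε t / 2 * (N t - Ns))
      - b t * θ * t * (‖deriv x t‖ ^ 2 + ‖deriv y t‖ ^ 2) := fun t ht => by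
    obtain ⟨e1, he1, hle1⟩ := half_energy_s17 hf hfconv (xs := xh) (htpos t ht) hθ (hx t ht) (hxd t ht)
      (hαd t ht) (hβd t ht) (hεd t ht) (hβpos t (hge t ht)) (hαε t (hge t ht)) (heqx t ht)
    obtain ⟨e2, he2, hle2⟩ := half_energy_s17 hg hgconv (xs := yh) (htpos t ht) hθ (hy t ht) (hyd t ht)
      (hαd t ht) (hβd t ht) (hεd t ht) (hβpos t (hge t ht)) (hαε t (hge t ht)) (heqy t ht)
    refine ⟨e1 + e2, he1.add he2, ?_⟩
    have k1 : ContinuousLinearMap.adjoint K (y t - yh)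
        + (θ * t) • ContinuousLinearMap.adjoint K (deriv y t)
        = ContinuousLinearMap.adjoint K (vy t) := by
      simp only [hvy, map_add, map_smul]
    have k2 : -(K (x t - xh)) + (θ * t) • (-(K (deriv x t))) = -(K (vx t)) := by
      simp only [hvx, map_add, map_smul, smul_neg]; abel
    rw [k1, ContinuousLinearMap.adjoint_inner_right] at hle1
    have k3 : ⟪y t - yh + (θ * t) • deriv y t, K (vx t)⟫ = ⟪K (vx t), vy t⟫ :=
      real_inner_comm _ _
    rw [k2, inner_neg_right, k3] at hle2
    change e1 ≤ R' t * (Dx t + ε t / 2 * ‖x t‖ ^ 2)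
      + θ ^ 2 * t ^ 2 * β t * (deriv ε t / 2 * ‖x t‖ ^ 2)
      - θ * t * β t * (Dx t + ε t / 2 * (‖x t‖ ^ 2 - ‖xh‖ ^ 2))
      - b t * θ * t * ‖deriv x t‖ ^ 2 - θ * t * β t * ⟪K (vx t), vy t⟫ at hle1
    change e2 ≤ R' t * (Dy t + ε t / 2 * ‖y t‖ ^ 2)
      + θ ^ 2 * t ^ 2 * β t * (deriv ε t / 2 * ‖y t‖ ^ 2)
      - θ * t * β t * (Dy t + ε t / 2 * (‖y t‖ ^ 2 - ‖yh‖ ^ 2))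
      - b t * θ * t * ‖deriv y t‖ ^ 2 - θ * t * β t * (-⟪K (vx t), vy t⟫) at hle2
    simp only [hN, hNs]
    linarith
  choose! E' hE' hE'le using hEd
  have hElb : ∀ t ≥ T, θ ^ 2 * t ^ 2 * β t * (Dx t + Dy t + ε t / 2 * N t)
      + 1 / 2 * ‖vx t‖ ^ 2 + 1 / 2 * ‖vy t‖ ^ 2 ≤ E t := fun t ht => by
    have h1 : E t = θ ^ 2 * t ^ 2 * β t * (Dx t + Dy t + ε t / 2 * N t)
      + 1 / 2 * ‖vx t‖ ^ 2 + 1 / 2 * ‖vy t‖ ^ 2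
      + b t / 2 * (‖x t - xh‖ ^ 2 + ‖y t - yh‖ ^ 2) := by
      simp only [hE, halfE, hDx, hDy, hN, hvx, hvy, hb]; ring
    have h2 : 0 ≤ b t / 2 * (‖x t - xh‖ ^ 2 + ‖y t - yh‖ ^ 2) := by
      have := hb0 t ht; positivity
    linarith
  have hφ0 : ∀ t ≥ T, 0 ≤ θ ^ 2 * t ^ 2 * β t * (Dx t + Dy t + ε t / 2 * N t) := fun t ht => by
    have h1 := hβpos t (hge t ht)
    have h2 := hεpos t (hge t ht)
    have h3 := hDx0 t
    have h4 := hDy0 t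
    have h5 := hN0 t
    positivity
  have hE0 : ∀ t ≥ T, 0 ≤ E t := fun t ht => by
    have := hElb t ht
    have := hφ0 t ht
    have := sq_nonneg ‖vx t‖
    have := sq_nonneg ‖vy t‖
    linarith
  -- the primitive of `t β ε`
  obtain ⟨A, hAd, hA0⟩ := exists_prim ht₀ (w := fun t => β t * ε t)
    (fun t ht => (mul_pos (hβpos t ht.le) (hεpos t ht.le)).le) hTt0
    ((hβC1.continuousOn.mono Set.Ioi_subset_Ici_self).mul
      (hεC1.continuousOn.mono Set.Ioi_subset_Ici_self)) hεint
  set c0 : ℝ := θ / 2 * Ns with hc0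
  have hE'1 : ∀ t ≥ T, b t * θ * t * (‖deriv x t‖ ^ 2 + ‖deriv y t‖ ^ 2)
      ≤ c0 * (t * (β t * ε t)) - E' t := fun t ht => by
    have h1 := hE'le t ht
    have h2 := hR'le t ht
    have h3 := hβpos t (hge t ht)
    have h4 := hεpos t (hge t ht)
    have h5 : 0 ≤ Dx t + Dy t + ε t / 2 * N t := by
      have h3 := hDx0 t
      have h4 := hDy0 t
      have h5 := hN0 t
      positivity
    have h6 := mul_le_mul_of_nonneg_right h2 h5
    have h7 : θ ^ 2 * t ^ 2 * β t * (deriv ε t / 2 * N t) ≤ 0 := by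
      apply mul_nonpos_of_nonneg_of_nonpos (by positivity)
      apply mul_nonpos_of_nonpos_of_nonneg _ (hN0 t)
      linarith [hε'np t ht]
    have h8 : c0 * (t * (β t * ε t)) = θ * t * β t * (ε t / 2 * Ns) := by simp only [hc0]; ring
    rw [h8]
    nlinarith
  set W : ℝ → ℝ := fun t => c0 * A t - E t with hW
  have hWd : ∀ t ≥ T, HasDerivAt W (c0 * (t * (β t * ε t)) - E' t) t := fun t ht =>
    ((hAd t ht).const_mul c0).sub (hE' t ht)
  have mono : ∀ (F F' : ℝ → ℝ) (S : ℝ), (∀ t ≥ S, HasDerivAt F (F' t) t) → (∀ t ≥ S, 0 ≤ F' t) →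
      ∀ t ≥ S, F S ≤ F t := by
    intro F F' S h1 h2 t ht
    have : MonotoneOn F (Set.Ici S) := by
      apply monotoneOn_of_deriv_nonneg (convex_Ici S)
      · exact fun t ht => (h1 t ht).continuousAt.continuousWithinAt
      · exact fun t ht => (h1 t (interior_subset ht)).differentiableAt.differentiableWithinAt
      · intro t ht
        rw [(h1 t (interior_subset ht)).deriv]
        exact h2 t (interior_subset ht)
    exact this (Set.mem_Ici.2 le_rfl) ht ht
  have hWmono : ∀ t ≥ T, W T ≤ W t := mono W _ T hWd (fun t ht => by
    refine le_trans ?_ (hE'1 t ht)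
    have := hb0 t ht
    have := htpos t ht
    positivity)
  have hsq : Tendsto (fun t : ℝ => t ^ 2) atTop atTop := tendsto_pow_atTop two_ne_zero
  have hEt : Tendsto (fun t => E t / t ^ 2) atTop (nhds 0) := by
    have h1 : Tendsto (fun t => c0 * (A t / t ^ 2) + (-W T) / t ^ 2) atTop (nhds 0) := by
      simpa using (hA0.const_mul c0).add (tendsto_const_nhds.div_atTop hsq)
    refine squeeze_zero' ?_ ?_ h1
    · filter_upwards [eventually_ge_atTop T] with t ht
      have := hE0 t ht; positivity
    · filter_upwards [eventually_ge_atTop T] with t ht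
      have h2 := hWmono t ht
      have h3 : E t ≤ c0 * A t + -W T := by
        have : W t = c0 * A t - E t := rfl
        linarith
      calc E t / t ^ 2 ≤ (c0 * A t + -W T) / t ^ 2 := by gcongr
        _ = _ := by ring
  have hWt : Tendsto (fun t => W t / t ^ 2) atTop (nhds 0) := by
    have := (hA0.const_mul c0).sub hEt
    simp only [mul_zero, sub_zero] at this
    refine this.congr fun t => ?_
    simp only [hW]; ring
  have hbt : Tendsto (fun t => b t / t ^ 2) atTop (nhds 0) := by
    have hm := mono (fun t => A t - t * α t) (fun t => t * (β t * ε t) - (1 * α t + t * deriv α t))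
      T (fun t ht => (hAd t ht).sub ((hasDerivAt_id' t).mul (hαd t ht)))
      (fun t ht => by have := hαε t (hge t ht); nlinarith)
    have h1 : Tendsto (fun t => θ * (A t / t ^ 2) + (-(θ * (A T - T * α T))) / t ^ 2) atTop
        (nhds 0) := by
      simpa using (hA0.const_mul θ).add (tendsto_const_nhds.div_atTop hsq)
    refine squeeze_zero' ?_ ?_ h1
    · filter_upwards [eventually_ge_atTop T] with t ht
      have := hb0 t ht; positivity
    · filter_upwards [eventually_ge_atTop T] with t ht
      have h2 := hm t ht
      have h4 := mul_le_mul_of_nonneg_left h2 hθ.le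
      have h3 : b t ≤ θ * A t + -(θ * (A T - T * α T)) := by
        simp only [hb]; nlinarith
      calc b t / t ^ 2 ≤ (θ * A t + -(θ * (A T - T * α T))) / t ^ 2 := by gcongr
        _ = _ := by ring
  -- gap and Tikhonov term vanish
  have hφ : Tendsto (fun t => Dx t + Dy t + ε t / 2 * N t) atTop (nhds 0) := by
    have h1 : Tendsto (fun t => (θ ^ 2 * c)⁻¹ * (E t / t ^ 2)) atTop (nhds 0) := by
      simpa only [mul_zero] using hEt.const_mul (θ ^ 2 * c)⁻¹
    refine squeeze_zero' ?_ ?_ h1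
    · filter_upwards [eventually_ge_atTop T] with t ht
      have h2 := hεpos t (hge t ht)
      have h3 := hDx0 t
      have h4 := hDy0 t
      have h5 := hN0 t
      positivity
    · filter_upwards [eventually_ge_atTop T] with t ht
      have h2 := hεpos t (hge t ht)
      have h3 := hDx0 t
      have h4 := hDy0 t
      have h5 := hN0 t
      have h6 := htpos t ht
      have h7 : θ ^ 2 * t ^ 2 * c * (Dx t + Dy t + ε t / 2 * N t) ≤ E t := by
        refine le_trans ?_ ((le_add_of_nonneg_right (by positivity)).trans
          ((le_add_of_nonneg_right (by positivity)).trans (hElb t ht)))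
        gcongr
        exact hβc t ht
      have h8 : (θ ^ 2 * c)⁻¹ * (E t / t ^ 2) = E t / (θ ^ 2 * t ^ 2 * c) := by field_simp
      rw [h8, le_div_iff₀ (by positivity)]
      linarith
  have hsqz : ∀ F : ℝ → ℝ, (∀ t ≥ T, 0 ≤ F t) →
      (∀ t ≥ T, F t ≤ Dx t + Dy t + ε t / 2 * N t) → Tendsto F atTop (nhds 0) := by
    intro F h1 h2
    refine squeeze_zero' ?_ ?_ hφ
    · filter_upwards [eventually_ge_atTop T] with t ht using h1 t ht
    · filter_upwards [eventually_ge_atTop T] with t ht using h2 t ht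
  have hεN0 : ∀ t ≥ T, 0 ≤ ε t / 2 * N t := fun t ht => by
    have h2 := hεpos t (hge t ht)
    have h5 := hN0 t
    positivity
  have hDxt : Tendsto Dx atTop (nhds 0) := hsqz Dx (fun t _ => hDx0 t)
    (fun t ht => by linarith [hDy0 t, hεN0 t ht])
  have hDyt : Tendsto Dy atTop (nhds 0) := hsqz Dy (fun t _ => hDy0 t)
    (fun t ht => by linarith [hDx0 t, hεN0 t ht])
  have hεNt : Tendsto (fun t => ε t / 2 * N t) atTop (nhds 0) := hsqz _ hεN0
    (fun t ht => by linarith [hDx0 t, hDy0 t])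
  have sq_lim : ∀ {k : ℕ} (F : ℝ → EuclideanSpace ℝ (Fin k)),
      Tendsto (fun t => ‖F t‖ ^ 2) atTop (nhds 0) → Tendsto F atTop (nhds 0) := by
    intro k F h
    rw [tendsto_zero_iff_norm_tendsto_zero]
    have := h.sqrt
    simpa using this
  have hεle : ∀ t ≥ T, ε t ≤ ε T := fun t ht => hεanti (hge T le_rfl) (hge t ht) ht
  have hεvec : ∀ {k : ℕ} (F : ℝ → EuclideanSpace ℝ (Fin k)), (∀ t, ‖F t‖ ^ 2 ≤ N t) →
      Tendsto (fun t => ε t • F t) atTop (nhds 0) := by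
    intro k F hF
    apply sq_lim
    have h1 : Tendsto (fun t => 2 * ε T * (ε t / 2 * N t)) atTop (nhds 0) := by
      simpa using hεNt.const_mul (2 * ε T)
    refine squeeze_zero' (Eventually.of_forall fun t => by positivity) ?_ h1
    filter_upwards [eventually_ge_atTop T] with t ht
    have h2 := hεpos t (hge t ht)
    have h3 := hεle t ht
    have h4 := hN0 t
    rw [norm_smul, mul_pow, Real.norm_of_nonneg h2.le]
    calc ε t ^ 2 * ‖F t‖ ^ 2 ≤ ε t ^ 2 * N t := by gcongr; exact hF t
      _ = ε t * (ε t * N t) := by ring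
      _ ≤ ε T * (ε t * N t) := by gcongr
      _ = _ := by ring
  have hgx : Tendsto (fun t => gradient f (x t) - gradient f xh) atTop (nhds 0) := by
    apply sq_lim
    have h1 : Tendsto (fun t => 4 * L₁ * Dx t) atTop (nhds 0) := by
      simpa using hDxt.const_mul (4 * L₁)
    exact squeeze_zero (fun t => by positivity)
      (fun t => bregman hf hfconv hL₁ hfLip xh (x t)) h1
  have hgy : Tendsto (fun t => gradient g (y t) - gradient g yh) atTop (nhds 0) := by
    apply sq_lim
    have h1 : Tendsto (fun t => 4 * L₂ * Dy t) atTop (nhds 0) := by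
      simpa using hDyt.const_mul (4 * L₂)
    exact squeeze_zero (fun t => by positivity)
      (fun t => bregman hg hgconv hL₂ hgLip yh (y t)) h1
  have he0x : Tendsto (fun t => gradient f (x t) - gradient f xh + ε t • x t) atTop (nhds 0) := by
    simpa using hgx.add (hεvec x (fun t => by simp only [hN]; linarith [sq_nonneg ‖y t‖]))
  have he0y : Tendsto (fun t => gradient g (y t) - gradient g yh + ε t • y t) atTop (nhds 0) := by
    simpa using hgy.add (hεvec y (fun t => by simp only [hN]; linarith [sq_nonneg ‖x t‖]))
  -- velocity-type bound
  obtain ⟨S, hSall⟩ := ((hEt.eventually_le_const (show (0:ℝ) < 1 / 2 by norm_num)).and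
    (eventually_ge_atTop T)).exists_forall_of_atTop
  have hST : T ≤ S := (hSall S le_rfl).2
  have hSpos : 0 < S := hT.trans_le hST
  have hES : ∀ t ≥ S, E t ≤ 1 / 2 * t ^ 2 := fun t ht => by
    have h1 := (hSall t ht).1
    have h2 : 0 < t := hSpos.trans_le ht
    rwa [div_le_iff₀ (by positivity)] at h1
  have hvxS : ∀ t ≥ S, ‖x t - xh + (θ * t) • deriv x t‖ ≤ 1 * t := fun t ht => by
    have h1 := hES t ht
    have h2 := hElb t (hST.trans ht)
    have h3 := hφ0 t (hST.trans ht)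
    have h4 := sq_nonneg ‖vy t‖
    rw [one_mul]
    apply le_of_sq_le_sq _ (hSpos.le.trans ht)
    change ‖vx t‖ ^ 2 ≤ t ^ 2
    linarith
  have hvyS : ∀ t ≥ S, ‖y t - yh + (θ * t) • deriv y t‖ ≤ 1 * t := fun t ht => by
    have h1 := hES t ht
    have h2 := hElb t (hST.trans ht)
    have h3 := hφ0 t (hST.trans ht)
    have h4 := sq_nonneg ‖vx t‖
    rw [one_mul]
    apply le_of_sq_le_sq _ (hSpos.le.trans ht)
    change ‖vy t‖ ^ 2 ≤ t ^ 2
    linarith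
  have hKy : Tendsto (fun t => ContinuousLinearMap.adjoint K (y t - yh)) atTop (nhds 0) := by
    refine half_res (f := f) (xs := xh) hθ hc hSpos (fun t ht => hx t (hST.trans ht))
      (fun t ht => hxd t (hST.trans ht))
      (Pd := fun t => ContinuousLinearMap.adjoint K (deriv y t)) ?_
      (fun t ht => hβd t (hST.trans ht)) (fun t ht => hβc t (hST.trans ht))
      (fun t ht => hβ' t (hge t (hST.trans ht))) (fun t ht => heqx t (hST.trans ht))
      hvxS (fun t ht => hWd t (hST.trans ht)) ?_ (fun t ht => hb0 t (hST.trans ht)) hWt hbt he0x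
    · intro t ht
      exact (ContinuousLinearMap.adjoint K).hasFDerivAt.comp_hasDerivAt t
        ((hy t (hST.trans ht)).sub_const yh)
    · intro t ht
      refine le_trans ?_ (hE'1 t (hST.trans ht))
      have h1 := hb0 t (hST.trans ht)
      have h2 := htpos t (hST.trans ht)
      change b t * θ * t * ‖deriv x t‖ ^ 2 ≤ _
      gcongr
      linarith [sq_nonneg ‖deriv y t‖]
  have hKx : Tendsto (fun t => -(K (x t - xh))) atTop (nhds 0) := by
    refine half_res (f := g) (xs := yh) hθ hc hSpos (fun t ht => hy t (hST.trans ht))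
      (fun t ht => hyd t (hST.trans ht))
      (Pd := fun t => -(K (deriv x t))) ?_
      (fun t ht => hβd t (hST.trans ht)) (fun t ht => hβc t (hST.trans ht))
      (fun t ht => hβ' t (hge t (hST.trans ht))) (fun t ht => heqy t (hST.trans ht))
      hvyS (fun t ht => hWd t (hST.trans ht)) ?_ (fun t ht => hb0 t (hST.trans ht)) hWt hbt he0y
    · intro t ht
      exact (K.hasFDerivAt.comp_hasDerivAt t ((hx t (hST.trans ht)).sub_const xh)).neg
    · intro t ht
      refine le_trans ?_ (hE'1 t (hST.trans ht))
      have h1 := hb0 t (hST.trans ht)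
      have h2 := htpos t (hST.trans ht)
      change b t * θ * t * ‖deriv y t‖ ^ 2 ≤ _
      gcongr
      linarith [sq_nonneg ‖deriv x t‖]
  have hKyn := hKy.norm
  have hKxn := hKx.norm
  simp only [norm_zero, norm_neg] at hKyn hKxn
  -- closeness to the minimal norm saddle point
  have hclose : ∀ δ > 0, ∃ η > 0, ∀ᶠ t in atTop, N t < Ns + η →
      Real.sqrt (‖x t - xh‖ ^ 2 + ‖y t - yh‖ ^ 2) < δ := by
    intro δ hδ
    obtain ⟨η, hη, hcl⟩ := compact_lemma hf hg hfconv hgconv hmin hδ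
    refine ⟨η, hη, ?_⟩
    filter_upwards [hDxt.eventually_lt_const hη, hDyt.eventually_lt_const hη,
      hKxn.eventually_lt_const hη, hKyn.eventually_lt_const hη] with t a1 a2 a3 a4 a5
    exact hcl (x t) (y t) a1 a2 a3 a4 a5
  have hconv : (∀ η > 0, ∀ᶠ t in atTop, N t < Ns + η) →
      Tendsto (fun t => Real.sqrt (‖x t - xh‖ ^ 2 + ‖y t - yh‖ ^ 2)) atTop (nhds 0) := by
    intro h
    rw [Metric.tendsto_nhds]
    intro δ hδ
    obtain ⟨η, hη, hcl⟩ := hclose δ hδ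
    filter_upwards [hcl, h η hη] with t h1 h2
    rw [dist_zero_right, Real.norm_of_nonneg (Real.sqrt_nonneg _)]
    exact h1 h2
  have hout : ∀ T₁ ≥ T, (∀ t ≥ T₁, Ns ≤ N t) → ∀ η > 0, ∀ᶠ t in atTop, N t < Ns + η := by
    intro T₁ hT₁ hNge η hη
    have hRd : ∀ t ≥ T, HasDerivAt (fun t => θ ^ 2 * t ^ 2 * β t * ε t * (Ns / 2) - E t)
        ((R' t * ε t + θ ^ 2 * t ^ 2 * β t * deriv ε t) * (Ns / 2) - E' t) t := fun t ht => by
      have h2 : HasDerivAt (fun t : ℝ => t ^ 2) (2 * t) t := by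
        simpa using hasDerivAt_pow 2 t
      have h3 := ((((h2.const_mul (θ ^ 2)).mul (hβd t ht)).mul (hεd t ht)).mul_const (Ns / 2)).sub
        (hE' t ht)
      refine h3.congr_deriv ?_
      simp only [hR', Pi.mul_apply]; ring
    have hm := mono _ _ T₁ (fun t ht => hRd t (hT₁.trans ht)) (fun t ht => by
      have hT' := hT₁.trans ht
      have h1 := hE'le t hT'
      have h2 := hR'le t hT'
      have h3 := hβpos t (hge t hT')
      have h4 := hεpos t (hge t hT')
      have hNN := sub_nonneg.2 (hNge t ht)
      have hb' := hb0 t hT'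
      have htp := htpos t hT'
      have h5 : 0 ≤ Dx t + Dy t + ε t / 2 * (N t - Ns) := by
        have h3 := hDx0 t
        have h4 := hDy0 t
        positivity
      have h6 := mul_le_mul_of_nonneg_right h2 h5
      have h7 : θ ^ 2 * t ^ 2 * β t * (deriv ε t / 2 * (N t - Ns)) ≤ 0 := by
        apply mul_nonpos_of_nonneg_of_nonpos (by positivity)
        apply mul_nonpos_of_nonpos_of_nonneg _ hNN
        linarith [hε'np t hT']
      have h8 : 0 ≤ b t * θ * t * (‖deriv x t‖ ^ 2 + ‖deriv y t‖ ^ 2) := by positivity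
      linarith)
    set M : ℝ := -(θ ^ 2 * T₁ ^ 2 * β T₁ * ε T₁ * (Ns / 2) - E T₁) with hM
    have hlim : Tendsto (fun t => (2 * M / θ ^ 2) / (t ^ 2 * β t * ε t)) atTop (nhds 0) :=
      tendsto_const_nhds.div_atTop hβεtop
    filter_upwards [hlim.eventually_lt_const hη, eventually_ge_atTop T₁] with t h1 ht
    have hT' := hT₁.trans ht
    have h2 := hm t ht
    have h3 := hElb t hT'
    have h4 := sq_nonneg ‖vx t‖
    have h5 := sq_nonneg ‖vy t‖
    have b3 := hβpos t (hge t hT')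
    have b4 := hεpos t (hge t hT')
    have htp := htpos t hT'
    have h6 : 0 ≤ θ ^ 2 * t ^ 2 * β t * (Dx t + Dy t) := by
      have h3 := hDx0 t
      have h4 := hDy0 t
      positivity
    have h7 : θ ^ 2 * t ^ 2 * β t * ε t * (N t - Ns) ≤ 2 * M := by
      linarith
    have h8 : N t - Ns ≤ (2 * M / θ ^ 2) / (t ^ 2 * β t * ε t) := by
      rw [div_div, le_div_iff₀ (by positivity)]
      linarith
    linarith
  constructor
  · apply liminf_zero (fun t => Real.sqrt_nonneg _)
    intro δ hδ
    obtain ⟨η, hη, hcl⟩ := hclose δ hδ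
    have hfreq : ∃ᶠ t in atTop, N t < Ns + η := by
      by_contra hcon
      rw [not_frequently] at hcon
      obtain ⟨T₁, hT₁⟩ := (hcon.and (eventually_ge_atTop T)).exists_forall_of_atTop
      have h1 := hout T₁ (hT₁ T₁ le_rfl).2 (fun t ht => by
        have := not_lt.1 (hT₁ t ht).1
        linarith) η hη
      obtain ⟨t, h2, h3⟩ := (h1.and hcon).exists
      exact h3 h2
    exact (hfreq.and_eventually hcl).mono fun t h => h.2 h.1
  · rintro ⟨T₁, hT₁, hin | hout'⟩
    · apply hconv
      intro η hη
      filter_upwards [eventually_ge_atTop T₁] with t ht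
      have h1 : N t < Ns := hin t ht
      linarith
    · apply hconv
      exact hout (max T T₁) (le_max_left _ _)
        (fun t ht => not_lt.1 (hout' t ((le_max_right _ _).trans ht)))
end
end
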